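/- arXiv:1905.01571 — 7 statements merged into one kernel-verified Lean document; each statement's English description precedes it below -/
import Mathlib

section
/- The chosen uniform steady states of the two-lane ARZ model solve the equilibrium (source-balance) equations: (i) ρ_s*/T_s − ρ_f*/T_f = 0; (ii) ρ_s* v_s*/T_s − ρ_f* v_f*/T_f + ρ_f*(V(ρ_f*) − v_f*)/T_f^e = 0; (iii) ρ_f* v_f*/T_f − ρ_s* v_s*/T_s + ρ_s*(V(ρ_s*) − v_s*)/T_s^e = 0. -/
/-- The chosen uniform steady states of the two-lane ARZ model solve the
equilibrium (source-balance) equations. -/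
theorem stmt_0
    (Tf Ts Tfe Tse vm ρm γ ρs : ℝ)
    (hTf : 0 < Tf) (hTs : 0 < Ts) (hTfe : 0 < Tfe) (hTse : 0 < Tse)
    (hvm : 0 < vm) (hρm : 0 < ρm) (hγ : 0 < γ) (hρs : 0 < ρs)
    (σ D rf rs ρf vf vs : ℝ) (V : ℝ → ℝ)
    (hσ : σ = Tf / Ts)
    (hD : D = 1 + Tfe / Tf + Tse / Ts)
    (hrf : rf = (1 + σ ^ (-γ) * (Tfe / Tf) + Tse / Ts) / D)
    (hrs : rs = (1 + Tfe / Tf + σ ^ γ * (Tse / Ts)) / D)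
    (hρf : ρf = σ * ρs)
    (hvf : vf = vm * (1 - rf * (ρf / ρm) ^ γ))
    (hvs : vs = vm * (1 - rs * (ρs / ρm) ^ γ))
    (hV : ∀ ρ : ℝ, V ρ = vm * (1 - (ρ / ρm) ^ γ)) :
    ρs / Ts - ρf / Tf = 0 ∧
    ρs * vs / Ts - ρf * vf / Tf + ρf * (V ρf - vf) / Tfe = 0 ∧
    ρf * vf / Tf - ρs * vs / Ts + ρs * (V ρs - vs) / Tse = 0 := by
  have hσpos : 0 < σ := hσ ▸ div_pos hTf hTs
  have hDpos : 0 < D := by rw [hD]; positivity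
  have hpow : (ρf / ρm) ^ γ = σ ^ γ * (ρs / ρm) ^ γ := by
    rw [hρf, mul_div_assoc, Real.mul_rpow hσpos.le (by positivity)]
  have hflux : ρf / Tf = ρs / Ts := by
    rw [hρf, hσ]; field_simp
  rw [Real.rpow_neg hσpos.le] at hrf
  have ha : 0 < σ ^ γ := Real.rpow_pos_of_pos hσpos γ
  rw [hpow] at hvf
  rw [hV, hV, hpow]
  generalize σ ^ γ = a at *
  generalize (ρs / ρm) ^ γ = P at *
  have hdiff : vs - vf = vm * P * (a - 1) / D := by
    rw [hvs, hvf, hrf, hrs]; field_simp; ring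
  have hf : vm * (1 - a * P) - vf = vm * P * (1 - a) * (Tfe / Tf) / D := by
    have hrf' : rf * a - a = (1 - a) * (Tfe / Tf) / D := by
      rw [hrf, eq_div_iff hDpos.ne', sub_mul]
      nth_rewrite 3 [hD]
      field_simp
      ring
    rw [hvf]
    linear_combination vm * P * hrf'
  have hs : vm * (1 - P) - vs = vm * P * (a - 1) * (Tse / Ts) / D := by
    have hrs' : rs - 1 = (a - 1) * (Tse / Ts) / D := by
      rw [hrs, eq_div_iff hDpos.ne', sub_mul, div_mul_cancel₀ _ hDpos.ne', hD]
      ring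
    rw [hvs]
    linear_combination vm * P * hrs'
  refine ⟨by rw [hflux, sub_self], ?_, ?_⟩
  · have hbal : ρf * (vm * (1 - a * P) - vf) / Tfe = ρf / Tf * (vf - vs) := by
      rw [hf, ← neg_sub vs vf, hdiff]; field_simp; ring
    rw [hbal]
    linear_combination -vs * hflux
  · have hbal : ρs * (vm * (1 - P) - vs) / Tse = ρs / Ts * (vs - vf) := by
      rw [hs, hdiff]; field_simp
    rw [hbal]
    linear_combination vf * hflux
end

section
/- In the congested regime with drivers preferring the slow lane, the four characteristic speeds of the linearized two-lane ARZ model are ordered as −μ_1 < −μ_2 < 0 < ε_1 < ε_2, where ε_1 := v_s*, ε_2 := v_f*, μ_1 := γ p_s* − v_s*, μ_2 := γ p_f* − v_f*. Precisely: assume 0 < σ < 1, v_s* > 0, γ p_s* > v_s* and γ p_f* > v_f*; then 0 < v_s* < v_f* and γ p_s* − v_s* > γ p_f* − v_f* > 0. -/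
/-- In the congested regime with drivers preferring the slow lane, the four
characteristic speeds of the linearized two-lane ARZ model are ordered as
−μ₁ < −μ₂ < 0 < ε₁ < ε₂: assuming 0 < σ < 1, v_s* > 0, γp_s* > v_s* and
γp_f* > v_f*, one has 0 < v_s* < v_f* and γp_s* − v_s* > γp_f* − v_f* > 0. -/
theorem stmt_3
    (Tf Ts Tfe Tse vm ρm γ ρs : ℝ)
    (hTf : 0 < Tf) (hTs : 0 < Ts) (hTfe : 0 < Tfe) (hTse : 0 < Tse)
    (hvm : 0 < vm) (hρm : 0 < ρm) (hγ : 0 < γ) (hρs : 0 < ρs)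
    (σ D rf rs ρf vf vs ps pf : ℝ)
    (hσ : σ = Tf / Ts)
    (hD : D = 1 + Tfe / Tf + Tse / Ts)
    (hrf : rf = (1 + σ ^ (-γ) * (Tfe / Tf) + Tse / Ts) / D)
    (hrs : rs = (1 + Tfe / Tf + σ ^ γ * (Tse / Ts)) / D)
    (hρf : ρf = σ * ρs)
    (hvf : vf = vm * (1 - rf * (ρf / ρm) ^ γ))
    (hvs : vs = vm * (1 - rs * (ρs / ρm) ^ γ))
    (hps : ps = vm * (ρs / ρm) ^ γ)
    (hpf : pf = vm * (ρf / ρm) ^ γ)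
    (hσ0 : 0 < σ) (hσ1 : σ < 1)
    (hvs0 : 0 < vs)
    (hμ1 : vs < γ * ps) (hμ2 : vf < γ * pf) :
    (0 < vs ∧ vs < vf) ∧
    (0 < γ * pf - vf ∧ γ * pf - vf < γ * ps - vs) := by
  have hs0 : 0 < σ ^ γ := Real.rpow_pos_of_pos hσ0 γ
  have hs1 : σ ^ γ < 1 := Real.rpow_lt_one hσ0.le hσ1 hγ
  have hx : 0 < (ρs / ρm) ^ γ := Real.rpow_pos_of_pos (div_pos hρs hρm) γ
  have hfx : (ρf / ρm) ^ γ = σ ^ γ * (ρs / ρm) ^ γ := by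
    rw [hρf, mul_div_assoc, Real.mul_rpow hσ0.le (div_pos hρs hρm).le]
  have hD0 : 0 < D := by rw [hD]; positivity
  have hr : rs - rf * σ ^ γ = (1 - σ ^ γ) / D := by
    rw [hrf, hrs, Real.rpow_neg hσ0.le]
    field_simp
    ring
  have hv : vs < vf := by
    have hdiff : vf - vs = vm * (ρs / ρm) ^ γ * ((1 - σ ^ γ) / D) := by
      rw [hvf, hvs, hfx, ← hr]
      ring
    have hpos : 0 < vm * (ρs / ρm) ^ γ * ((1 - σ ^ γ) / D) :=
      mul_pos (mul_pos hvm hx) (div_pos (sub_pos.2 hs1) hD0)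
    linarith
  have hp : pf < ps := by
    rw [hpf, hps, hfx]
    exact mul_lt_mul_of_pos_left (mul_lt_of_lt_one_left hx hs1) hvm
  have hγp : γ * pf < γ * ps := mul_lt_mul_of_pos_left hp hγ
  exact ⟨⟨hvs0, hv⟩, sub_pos.2 hμ2, by linarith⟩
end

section
/- Finite-time extinction for leftward transport with eventually vanishing forcing: let L > 0, μ > 0, T ≥ 0, let h : [0,L] × [0,∞) → ℝ be continuous with h(x,t) = 0 whenever t ≥ T, and let β be C¹ on [0,L] × [0,∞) with ∂_t β(x,t) = μ ∂_x β(x,t) + h(x,t) for all x ∈ [0,L], t ≥ 0, and β(L,t) = 0 for all t ≥ 0. Then β(x,t) = 0 for every x ∈ [0,L] and every t ≥ T + (L − x)/μ. -/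
/-- If `f` is differentiable at `(x, t)`, its derivative along the line through `(x, t)` with
direction `(μ, -1)` is `μ ∂ₓf - ∂ₜf`. -/
theorem hasDerivAt_along_characteristic {f : ℝ → ℝ → ℝ} {x t μ s : ℝ}
    (hf : DifferentiableAt ℝ (Function.uncurry f) (x + μ * s, t - s)) :
    HasDerivAt (fun r => f (x + μ * r) (t - r))
      (μ * deriv (fun y => f y (t - s)) (x + μ * s)
        - deriv (fun r => f (x + μ * s) r) (t - s)) s := by
  have hF := hf.hasFDerivAt
  set F := fderiv ℝ (Function.uncurry f) (x + μ * s, t - s)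
  have comp : ∀ {u v : ℝ → ℝ} {u' v' r : ℝ}, HasDerivAt u u' r → HasDerivAt v v' r →
      u r = x + μ * s → v r = t - s → HasDerivAt (fun r => f (u r) (v r)) (F (u', v')) r := by
    intro u v u' v' r hu hv hur hvr
    exact HasFDerivAt.comp_hasDerivAt (l := Function.uncurry f) (f := fun r => (u r, v r)) r
      (by simpa only [hur, hvr] using hF) (hu.prodMk hv)
  have hx := comp (hasDerivAt_id' (x + μ * s)) (hasDerivAt_const _ (t - s)) rfl rfl
  have ht := comp (hasDerivAt_const _ (x + μ * s)) (hasDerivAt_id' (t - s)) rfl rfl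
  have h1 : HasDerivAt (fun r => x + μ * r) μ s := by
    simpa using ((hasDerivAt_id s).const_mul μ).const_add x
  have h2 : HasDerivAt (fun r => t - r) (-1) s := by
    simpa using (hasDerivAt_id s).const_sub t
  have hc := comp h1 h2 rfl rfl
  rw [hx.deriv, ht.deriv]
  convert hc using 1
  have hv : ((μ, -1) : ℝ × ℝ) = μ • (1, 0) - (0, 1) := by simp
  rw [hv, map_sub, map_smul, smul_eq_mul]


/-- Finite-time extinction for leftward transport with eventually vanishing
forcing: if ∂ₜβ = μ∂ₓβ + h on [0,L]×[0,∞), h(·,t) ≡ 0 for t ≥ T, and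
β(L,t) = 0, then β(x,t) = 0 for t ≥ T + (L − x)/μ. -/
theorem stmt_7
    (L μ T : ℝ) (hL : 0 < L) (hμ : 0 < μ) (hT : 0 ≤ T)
    (h β : ℝ → ℝ → ℝ)
    (hh : ContinuousOn (Function.uncurry h) (Set.Icc 0 L ×ˢ Set.Ici 0))
    (hh0 : ∀ x ∈ Set.Icc (0:ℝ) L, ∀ t : ℝ, T ≤ t → h x t = 0)
    (hβ : ContDiffOn ℝ 1 (Function.uncurry β) (Set.Icc 0 L ×ˢ Set.Ici 0))
    (hpde : ∀ x ∈ Set.Icc (0:ℝ) L, ∀ t ∈ Set.Ici (0:ℝ),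
      deriv (fun s => β x s) t = μ * deriv (fun y => β y t) x + h x t)
    (hbc : ∀ t ∈ Set.Ici (0:ℝ), β L t = 0) :
    ∀ x ∈ Set.Icc (0:ℝ) L, ∀ t : ℝ, T + (L - x) / μ ≤ t → β x t = 0 := by
  intro x hx t ht
  rcases hx.2.eq_or_lt with rfl | hxL
  · exact hbc t (hT.trans (by simpa using ht))
  set S := (L - x) / μ with hS
  have hSpos : 0 < S := div_pos (sub_pos.2 hxL) hμ
  have hμS : μ * S = L - x := by rw [hS]; field_simp
  have hmaps : Set.MapsTo (fun s => (x + μ * s, t - s)) (Set.Icc 0 S)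
      (Set.Icc (0 : ℝ) L ×ˢ Set.Ici (0 : ℝ)) := by
    rintro s ⟨hs0, hsS⟩
    have h1 := mul_nonneg hμ.le hs0
    have h2 := mul_le_mul_of_nonneg_left hsS hμ.le
    refine ⟨⟨?_, ?_⟩, ?_⟩
    · linarith [hx.1]
    · change x + μ * s ≤ L
      linarith
    · change 0 ≤ t - s
      linarith
  have hcont : ContinuousOn (fun s => β (x + μ * s) (t - s)) (Set.Icc 0 S) :=
    hβ.continuousOn.comp (f := fun s => (x + μ * s, t - s)) (by fun_prop) hmaps
  have hderiv : ∀ s ∈ Set.Ioo 0 S,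
      HasDerivAt (fun r => β (x + μ * r) (t - r)) ((fun _ => (0 : ℝ)) s) s := by
    rintro s ⟨hs0, hsS⟩
    have h1 := mul_pos hμ hs0
    have h2 := mul_lt_mul_of_pos_left hsS hμ
    have hx0 : 0 < x + μ * s := by linarith [hx.1]
    have hxL' : x + μ * s < L := by linarith
    have ht0 : 0 < t - s := by linarith
    have hnhds : Set.Icc 0 L ×ˢ Set.Ici 0 ∈ nhds (x + μ * s, t - s) :=
      prod_mem_nhds (Icc_mem_nhds hx0 hxL') (Ici_mem_nhds ht0)
    have hd := hasDerivAt_along_characteristic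
      ((hβ.contDiffAt hnhds).differentiableAt one_ne_zero)
    rw [hpde _ ⟨hx0.le, hxL'.le⟩ _ ht0.le,
      hh0 _ ⟨hx0.le, hxL'.le⟩ _ (by linarith), add_zero, sub_self] at hd
    exact hd
  obtain ⟨_, _, hc⟩ := exists_hasDerivAt_eq_slope _ _ hSpos hcont hderiv
  have hend : β (x + μ * S) (t - S) = 0 := by
    rw [hμS, add_sub_cancel]
    exact hbc _ (by change 0 ≤ t - S; linarith)
  have hne : S - 0 ≠ 0 := by simpa using hSpos.ne'
  rw [eq_div_iff hne, zero_mul, hend] at hc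
  simpa using hc
end

section
/- Finite-time extinction for rightward transport with zero-order term, eventually vanishing forcing and eventually zero inflow: let L > 0, ε > 0, a ∈ ℝ, T ≥ 0, let h : [0,L] × [0,∞) → ℝ be continuous with h(x,t) = 0 whenever t ≥ T, and let α be C¹ on [0,L] × [0,∞) with ∂_t α(x,t) + ε ∂_x α(x,t) = a·α(x,t) + h(x,t) for all x ∈ [0,L], t ≥ 0, and α(0,t) = 0 for all t ≥ T. Then α(x,t) = 0 for every x ∈ [0,L] and every t ≥ T + x/ε. -/
/-- Chain rule along the line `s ↦ (c * s, b + s)`, in terms of partial derivatives. -/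
theorem hasDerivAt_along_line {α : ℝ → ℝ → ℝ} {c b s : ℝ}
    (hα : DifferentiableAt ℝ (Function.uncurry α) (c * s, b + s)) :
    HasDerivAt (fun r => α (c * r) (b + r))
      (deriv (fun r => α (c * s) r) (b + s) + c * deriv (fun y => α y (b + s)) (c * s)) s := by
  have hF := hα.hasFDerivAt
  set D := fderiv ℝ (Function.uncurry α) (c * s, b + s)
  have hx : HasDerivAt (fun y => α y (b + s)) (D (1, 0)) (c * s) :=
    hF.comp_hasDerivAt (f := fun y => (y, b + s)) (c * s)
      ((hasDerivAt_id (c * s)).prodMk (hasDerivAt_const (c * s) (b + s)))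
  have ht : HasDerivAt (fun r => α (c * s) r) (D (0, 1)) (b + s) :=
    hF.comp_hasDerivAt (b + s) ((hasDerivAt_const (b + s) (c * s)).prodMk (hasDerivAt_id (b + s)))
  have hl : HasDerivAt (fun r => α (c * r) (b + r)) (D (c, 1)) s := by
    have h1 : HasDerivAt (fun r => c * r) c s := by simpa using (hasDerivAt_id s).const_mul c
    have h2 : HasDerivAt (fun r => b + r) 1 s := (hasDerivAt_id s).const_add b
    exact hF.comp_hasDerivAt s (h1.prodMk h2)
  have hD : D (c, 1) = D (0, 1) + c * D (1, 0) := by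
    rw [← smul_eq_mul, ← map_smul, ← map_add]
    simp
  rwa [hx.deriv, ht.deriv, ← hD]

/-- Finite-time extinction for rightward transport with zero-order term,
eventually vanishing forcing and eventually zero inflow:
if ∂ₜα + ε∂ₓα = aα + h on [0,L]×[0,∞), h(·,t) ≡ 0 for t ≥ T, and α(0,t) = 0
for t ≥ T, then α(x,t) = 0 for t ≥ T + x/ε. -/
theorem stmt_10
    (L ε a T : ℝ) (hL : 0 < L) (hε : 0 < ε) (hT : 0 ≤ T)
    (h α : ℝ → ℝ → ℝ)
    (hh : ContinuousOn (Function.uncurry h) (Set.Icc 0 L ×ˢ Set.Ici 0))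
    (hh0 : ∀ x ∈ Set.Icc (0:ℝ) L, ∀ t : ℝ, T ≤ t → h x t = 0)
    (hα : ContDiffOn ℝ 1 (Function.uncurry α) (Set.Icc 0 L ×ˢ Set.Ici 0))
    (hpde : ∀ x ∈ Set.Icc (0:ℝ) L, ∀ t ∈ Set.Ici (0:ℝ),
      deriv (fun s => α x s) t + ε * deriv (fun y => α y t) x
        = a * α x t + h x t)
    (hbc : ∀ t : ℝ, T ≤ t → α 0 t = 0) :
    ∀ x ∈ Set.Icc (0:ℝ) L, ∀ t : ℝ, T + x / ε ≤ t → α x t = 0 := by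
  intro x hx t ht
  rcases hx.1.eq_or_lt with rfl | hx0
  · exact hbc t (by simpa using ht)
  set b := t - x / ε with hb
  have hbT : T ≤ b := by linarith
  have hS : 0 < x / ε := div_pos hx0 hε
  have hcont : ContinuousOn (fun s => Real.exp (-a * s) * α (ε * s) (b + s))
      (Set.Icc 0 (x / ε)) := by
    refine ContinuousOn.mul (by fun_prop) ?_
    refine hα.continuousOn.comp (f := fun s : ℝ => (ε * s, b + s)) (by fun_prop) ?_
    intro s hs
    have hsx : s * ε ≤ x := (le_div_iff₀ hε).1 hs.2
    exact ⟨⟨mul_nonneg hε.le hs.1, by linarith [hx.2]⟩, by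
      have := hs.1
      simp only [Set.mem_Ici]
      linarith⟩
  have hderiv : ∀ s ∈ Set.Ioo 0 (x / ε),
      HasDerivAt (fun s => Real.exp (-a * s) * α (ε * s) (b + s)) 0 s := by
    intro s hs
    have hsx : s * ε < x := (lt_div_iff₀ hε).1 hs.2
    have hs0 : 0 < ε * s := mul_pos hε hs.1
    have hsL : ε * s < L := by linarith [hx.2]
    have hbs : 0 < b + s := by linarith [hs.1]
    have hdiff : DifferentiableAt ℝ (Function.uncurry α) (ε * s, b + s) :=
      (hα.contDiffAt (prod_mem_nhds (Icc_mem_nhds hs0 hsL) (Ici_mem_nhds hbs))).differentiableAt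
        (by norm_num)
    have hline := hasDerivAt_along_line hdiff
    rw [hpde _ ⟨hs0.le, hsL.le⟩ _ hbs.le, hh0 _ ⟨hs0.le, hsL.le⟩ _ (by linarith [hs.1])] at hline
    have hexp : HasDerivAt (fun s => Real.exp (-a * s)) (Real.exp (-a * s) * -a) s := by
      simpa using ((hasDerivAt_id s).const_mul (-a)).exp
    exact (hexp.mul hline).congr_deriv (by ring)
  obtain ⟨s, -, hslope⟩ := exists_hasDerivAt_eq_slope _ (fun _ => 0) hS hcont hderiv
  have hεx : ε * (x / ε) = x := mul_div_cancel₀ x hε.ne'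
  have hbt : b + x / ε = t := by rw [hb]; ring
  simp only [hεx, hbt, mul_zero, add_zero, hbc b hbT, sub_zero] at hslope
  have hzero := (div_eq_zero_iff.1 hslope.symm).resolve_right hS.ne'
  exact (mul_eq_zero.1 hzero).resolve_left (Real.exp_pos _).ne'
end

section
/- Finite-time extinction of a coupled 2×2 leftward hyperbolic system with Volterra-type in-domain coupling and zero outlet data: let L > 0, μ₁ ≥ μ₂ > 0, let a₁, a₂ : [0,L] → ℝ and f_{ij} : [0,L]² → ℝ (i,j ∈ {1,2}) be continuous, and let β₁, β₂ be C¹ on [0,L] × [0,∞) satisfying, for all x ∈ [0,L], t ≥ 0: ∂_t β₁ − μ₁ ∂_x β₁ = a₁(x)β₂ + ∫ₓᴸ (f₁₁(x,ξ)β₁(ξ,t) + f₁₂(x,ξ)β₂(ξ,t)) dξ and ∂_t β₂ − μ₂ ∂_x β₂ = a₂(x)β₁ + ∫ₓᴸ (f₂₁(x,ξ)β₁(ξ,t) + f₂₂(x,ξ)β₂(ξ,t)) dξ, with β₁(L,t) = β₂(L,t) = 0 for all t ≥ 0. Then β₁(x,t) = β₂(x,t) = 0 for every x ∈ [0,L]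 and every t ≥ (L − x)/μ₂. -/
open Set

/-- A solution of a leftward transport equation vanishing at the outlet is controlled, along the
characteristic through `(x, t)`, by an exponentially weighted bound on its source. -/
theorem abs_le_exp_of_transport_source_le
    {L μ lam N x t : ℝ} (hμ : 0 < μ) (hN : 0 ≤ N)
    (hx : x ∈ Icc 0 L) (u : ℝ → ℝ → ℝ)
    (hu : ContDiffOn ℝ 1 (Function.uncurry u) (Icc 0 L ×ˢ Ici 0))
    (hbc : ∀ s ∈ Ici (0 : ℝ), u L s = 0)
    (ht : (L - x) / μ ≤ t)
    (hsource : ∀ y ∈ Ioo x L,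
      |deriv (fun s => u y s) (t - (y - x) / μ)
          - μ * deriv (fun z => u z (t - (y - x) / μ)) y|
        ≤ μ * (lam * (N * Real.exp (lam * (L - y))))) :
    |u x t| ≤ N * Real.exp (lam * (L - x)) := by
  have hpos : ∀ y ∈ Icc x L, 0 ≤ t - (y - x) / μ := by
    intro y hy
    have : (y - x) / μ ≤ (L - x) / μ := by gcongr; exact hy.2
    linarith
  have hpos' : ∀ y ∈ Ioo x L, 0 < t - (y - x) / μ := by
    intro y hy
    have : (y - x) / μ < (L - x) / μ := by gcongr; exact hy.2
    linarith
  have hcont : ContinuousOn (fun y => u y (t - (y - x) / μ)) (Icc x L) := by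
    refine hu.continuousOn.comp (f := fun y => (y, t - (y - x) / μ)) (by fun_prop) ?_
    exact fun y hy => ⟨⟨hx.1.trans hy.1, hy.2⟩, hpos y hy⟩
  have hderiv : ∀ y ∈ Ioo x L, ∃ d, HasDerivAt (fun y => u y (t - (y - x) / μ)) d y ∧
      |d| ≤ lam * (N * Real.exp (lam * (L - y))) := by
    intro y hy
    set s := t - (y - x) / μ with hs
    have hmem : Icc 0 L ×ˢ Ici 0 ∈ nhds (y, s) :=
      prod_mem_nhds (Icc_mem_nhds (hx.1.trans_lt hy.1) hy.2) (Ici_mem_nhds (hpos' y hy))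
    have hF := ((hu.contDiffAt hmem).differentiableAt (by norm_num)).hasFDerivAt
    set F := fderiv ℝ (Function.uncurry u) (y, s)
    have h1 : HasDerivAt (fun z => u z s) (F (1, 0)) y :=
      hF.comp_hasDerivAt (f := fun z => (z, s)) y ((hasDerivAt_id y).prodMk (hasDerivAt_const y s))
    have h2 : HasDerivAt (fun r => u y r) (F (0, 1)) s :=
      hF.comp_hasDerivAt (f := fun r => (y, r)) s ((hasDerivAt_const s y).prodMk (hasDerivAt_id s))
    have h3 : HasDerivAt (fun z => t - (z - x) / μ) (-(1 / μ)) y := by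
      simpa using (((hasDerivAt_id y).sub_const x).div_const μ).const_sub t
    have h4 : HasDerivAt (fun z => u z (t - (z - x) / μ)) (F (1, -(1 / μ))) y :=
      hF.comp_hasDerivAt (f := fun z => (z, t - (z - x) / μ)) y ((hasDerivAt_id y).prodMk h3)
    refine ⟨_, h4, ?_⟩
    have hb := hsource y hy
    rw [← hs, h1.deriv, h2.deriv] at hb
    have hlin : F (0, 1) - μ * F (1, 0) = -μ * F (1, -(1 / μ)) := by
      have : ((1 : ℝ), -(1 / μ)) = (1, 0) + (-(1 / μ)) • ((0 : ℝ), (1 : ℝ)) := by simp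
      rw [this, map_add, map_smul, smul_eq_mul]
      field_simp
      ring
    rw [hlin, abs_mul, abs_neg, abs_of_pos hμ] at hb
    exact le_of_mul_le_mul_left hb hμ
  have key : ∀ σ : ℝ, |σ| = 1 → 0 ≤ N * Real.exp (lam * (L - x)) - σ * u x t := by
    intro σ hσ
    have hexp : ∀ y, HasDerivAt (fun y => N * Real.exp (lam * (L - y)))
        (-(lam * (N * Real.exp (lam * (L - y))))) y := by
      intro y
      have := ((((hasDerivAt_id y).const_sub L).const_mul lam).exp).const_mul N
      exact this.congr_deriv (by simp only [id]; ring)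
    have hanti : AntitoneOn
        (fun y => N * Real.exp (lam * (L - y)) - σ * u y (t - (y - x) / μ)) (Icc x L) := by
      refine antitoneOn_of_deriv_nonpos (convex_Icc x L) ?_ ?_ ?_
      · exact (by fun_prop : Continuous fun y => N * Real.exp (lam * (L - y))).continuousOn.sub
          (hcont.const_mul σ)
      · rw [interior_Icc]
        intro y hy
        obtain ⟨d, hd, -⟩ := hderiv y hy
        exact ((hexp y).sub (hd.const_mul σ)).differentiableAt.differentiableWithinAt
      · rw [interior_Icc]
        intro y hy
        obtain ⟨d, hd, hb⟩ := hderiv y hy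
        have hσd : |σ * d| = |d| := by rw [abs_mul, hσ, one_mul]
        have := neg_abs_le (σ * d)
        refine ((hexp y).sub (hd.const_mul σ)).deriv.trans_le ?_
        linarith
    have h := hanti (left_mem_Icc.2 hx.2) (right_mem_Icc.2 hx.2) hx.2
    have h0 : u L (t - (L - x) / μ) = 0 := hbc _ (hpos L (right_mem_Icc.2 hx.2))
    simp only [h0, sub_self, mul_zero, Real.exp_zero, zero_div, sub_zero] at h
    linarith
  rw [abs_le]
  have h1 := key 1 (by simp)
  have h2 := key (-1) (by simp)
  constructor <;> linarith

/-- Pointwise bound on a Volterra-type source whose arguments are bounded on `[y, L]` by a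
decreasing exponential. -/
theorem abs_volterra_source_le
    {L lam A M y a b : ℝ} {f g v w : ℝ → ℝ} (hlam : 0 ≤ lam) (hA : 0 ≤ A) (hM : 0 ≤ M)
    (hy : y ∈ Icc 0 L) (ha : |a| ≤ A) (hb : |b| ≤ M * Real.exp (lam * (L - y)))
    (hf : ∀ ξ ∈ Icc y L, |f ξ| ≤ A) (hg : ∀ ξ ∈ Icc y L, |g ξ| ≤ A)
    (hv : ∀ ξ ∈ Icc y L, |v ξ| ≤ M * Real.exp (lam * (L - ξ)))
    (hw : ∀ ξ ∈ Icc y L, |w ξ| ≤ M * Real.exp (lam * (L - ξ))) :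
    |a * b + ∫ ξ in y..L, (f ξ * v ξ + g ξ * w ξ)|
      ≤ A * (1 + 2 * L) * (M * Real.exp (lam * (L - y))) := by
  set E := M * Real.exp (lam * (L - y)) with hE
  have hE0 : 0 ≤ E := by positivity
  have hmono : ∀ ξ ∈ Icc y L, M * Real.exp (lam * (L - ξ)) ≤ E := by
    intro ξ hξ
    rw [hE]
    gcongr
    exact hξ.1
  have hvolterra : ‖∫ ξ in y..L, (f ξ * v ξ + g ξ * w ξ)‖ ≤ (A * E + A * E) * |L - y| := by
    refine intervalIntegral.norm_integral_le_of_norm_le_const fun ξ hξ => ?_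
    rw [uIoc_of_le hy.2] at hξ
    have hξ' : ξ ∈ Icc y L := Ioc_subset_Icc_self hξ
    refine (norm_add_le _ _).trans (add_le_add ?_ ?_) <;> rw [Real.norm_eq_abs, abs_mul]
    · exact mul_le_mul (hf ξ hξ') ((hv ξ hξ').trans (hmono ξ hξ')) (abs_nonneg _) hA
    · exact mul_le_mul (hg ξ hξ') ((hw ξ hξ').trans (hmono ξ hξ')) (abs_nonneg _) hA
  rw [Real.norm_eq_abs, abs_of_nonneg (sub_nonneg.2 hy.2)] at hvolterra
  have h1 : |a * b| ≤ A * E := by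
    rw [abs_mul]
    exact mul_le_mul ha hb (abs_nonneg _) hA
  have h2 : (A * E + A * E) * (L - y) ≤ (A * E + A * E) * L := by
    gcongr
    linarith [hy.1]
  calc _ ≤ _ := abs_add_le _ _
    _ ≤ A * E + (A * E + A * E) * L := add_le_add h1 (hvolterra.trans h2)
    _ = _ := by ring


/-- Finite-time extinction of a coupled 2×2 leftward hyperbolic system with
Volterra-type in-domain coupling and zero outlet data: both states vanish for
t ≥ (L − x)/μ₂, where μ₁ ≥ μ₂ > 0 are the transport speeds. -/
theorem stmt_13
    (L μ₁ μ₂ : ℝ) (hL : 0 < L) (hμ₂ : 0 < μ₂) (hμ : μ₂ ≤ μ₁)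
    (a₁ a₂ : ℝ → ℝ) (f₁₁ f₁₂ f₂₁ f₂₂ : ℝ → ℝ → ℝ)
    (ha₁ : ContinuousOn a₁ (Set.Icc 0 L)) (ha₂ : ContinuousOn a₂ (Set.Icc 0 L))
    (hf₁₁ : ContinuousOn (Function.uncurry f₁₁) (Set.Icc 0 L ×ˢ Set.Icc 0 L))
    (hf₁₂ : ContinuousOn (Function.uncurry f₁₂) (Set.Icc 0 L ×ˢ Set.Icc 0 L))
    (hf₂₁ : ContinuousOn (Function.uncurry f₂₁) (Set.Icc 0 L ×ˢ Set.Icc 0 L))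
    (hf₂₂ : ContinuousOn (Function.uncurry f₂₂) (Set.Icc 0 L ×ˢ Set.Icc 0 L))
    (β₁ β₂ : ℝ → ℝ → ℝ)
    (hβ₁ : ContDiffOn ℝ 1 (Function.uncurry β₁) (Set.Icc 0 L ×ˢ Set.Ici 0))
    (hβ₂ : ContDiffOn ℝ 1 (Function.uncurry β₂) (Set.Icc 0 L ×ˢ Set.Ici 0))
    (hpde₁ : ∀ x ∈ Set.Icc (0:ℝ) L, ∀ t ∈ Set.Ici (0:ℝ),
      deriv (fun s => β₁ x s) t - μ₁ * deriv (fun y => β₁ y t) x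
        = a₁ x * β₂ x t
          + ∫ ξ in x..L, (f₁₁ x ξ * β₁ ξ t + f₁₂ x ξ * β₂ ξ t))
    (hpde₂ : ∀ x ∈ Set.Icc (0:ℝ) L, ∀ t ∈ Set.Ici (0:ℝ),
      deriv (fun s => β₂ x s) t - μ₂ * deriv (fun y => β₂ y t) x
        = a₂ x * β₁ x t
          + ∫ ξ in x..L, (f₂₁ x ξ * β₁ ξ t + f₂₂ x ξ * β₂ ξ t))
    (hbc₁ : ∀ t ∈ Set.Ici (0:ℝ), β₁ L t = 0)
    (hbc₂ : ∀ t ∈ Set.Ici (0:ℝ), β₂ L t = 0) :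
    ∀ x ∈ Set.Icc (0:ℝ) L, ∀ t : ℝ, (L - x) / μ₂ ≤ t →
      β₁ x t = 0 ∧ β₂ x t = 0 := by
  have hsq : IsCompact (Icc (0 : ℝ) L ×ˢ Icc (0 : ℝ) L) := isCompact_Icc.prod isCompact_Icc
  obtain ⟨c₁, hc₁⟩ := isCompact_Icc.exists_bound_of_continuousOn ha₁
  obtain ⟨c₂, hc₂⟩ := isCompact_Icc.exists_bound_of_continuousOn ha₂
  obtain ⟨c₁₁, hc₁₁⟩ := hsq.exists_bound_of_continuousOn hf₁₁
  obtain ⟨c₁₂, hc₁₂⟩ := hsq.exists_bound_of_continuousOn hf₁₂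
  obtain ⟨c₂₁, hc₂₁⟩ := hsq.exists_bound_of_continuousOn hf₂₁
  obtain ⟨c₂₂, hc₂₂⟩ := hsq.exists_bound_of_continuousOn hf₂₂
  simp only [Real.norm_eq_abs] at hc₁ hc₂ hc₁₁ hc₁₂ hc₂₁ hc₂₂
  obtain ⟨A, hA, h₁, h₂, h₁₁, h₁₂, h₂₁, h₂₂⟩ : ∃ A : ℝ, 0 ≤ A ∧ c₁ ≤ A ∧ c₂ ≤ A ∧ c₁₁ ≤ A ∧
      c₁₂ ≤ A ∧ c₂₁ ≤ A ∧ c₂₂ ≤ A :=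
    ⟨|c₁| + |c₂| + |c₁₁| + |c₁₂| + |c₂₁| + |c₂₂|, by positivity, by
      have := abs_nonneg c₁; have := abs_nonneg c₂; have := abs_nonneg c₁₁
      have := abs_nonneg c₁₂; have := abs_nonneg c₂₁; have := abs_nonneg c₂₂
      have := le_abs_self c₁; have := le_abs_self c₂; have := le_abs_self c₁₁
      have := le_abs_self c₁₂; have := le_abs_self c₂₁; have := le_abs_self c₂₂
      refine ⟨?_, ?_, ?_, ?_, ?_, ?_⟩ <;> linarith⟩
  have hμ₁ : 0 < μ₁ := hμ₂.trans_le hμ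
  obtain ⟨lam, hlam, hlamA⟩ : ∃ lam : ℝ, 0 ≤ lam ∧ A * (1 + 2 * L) = μ₂ * (lam / 2) :=
    ⟨2 * (A * (1 + 2 * L)) / μ₂, by positivity, by field_simp⟩
  intro x₀ hx₀ T hT
  have hT0 : 0 ≤ T := (div_nonneg (sub_nonneg.2 hx₀.2) hμ₂.le).trans hT
  let P : ℝ → Prop := fun M => ∀ x ∈ Icc (0 : ℝ) L, ∀ t, (L - x) / μ₂ ≤ t → t ≤ T →
    |β₁ x t| ≤ M * Real.exp (lam * (L - x)) ∧ |β₂ x t| ≤ M * Real.exp (lam * (L - x))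
  have hhalf : ∀ M, 0 ≤ M → P M → P (M / 2) := by
    intro M hM hP x hx t ht htT
    have hspeed : ∀ ν, μ₂ ≤ ν → ∀ y ∈ Icc x L, ∀ ξ ∈ Icc y L,
        (L - ξ) / μ₂ ≤ t - (y - x) / ν ∧ t - (y - x) / ν ≤ T := by
      intro ν hν y hy ξ hξ
      have hyx : 0 ≤ y - x := sub_nonneg.2 hy.1
      have e1 : (y - x) / ν ≤ (y - x) / μ₂ := by gcongr
      have e2 : (L - ξ) / μ₂ ≤ (L - y) / μ₂ := by gcongr; exact hξ.1
      have e3 : (L - x) / μ₂ = (L - y) / μ₂ + (y - x) / μ₂ := by ring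
      have e4 : 0 ≤ (y - x) / ν := div_nonneg hyx (hμ₂.le.trans hν)
      constructor <;> linarith
    have hsource : ∀ ν, μ₂ ≤ ν → ∀ y ∈ Ioo x L, ∀ r : ℝ,
        |r| ≤ A * (1 + 2 * L) * (M * Real.exp (lam * (L - y))) →
        |r| ≤ ν * (lam * (M / 2 * Real.exp (lam * (L - y)))) := by
      intro ν hν y _ r hr
      calc |r| ≤ μ₂ * (lam * (M / 2 * Real.exp (lam * (L - y)))) := by
            rw [hlamA] at hr; linarith
        _ ≤ _ := by gcongr
    constructor
    · refine abs_le_exp_of_transport_source_le hμ₁ (by positivity) hx β₁ hβ₁ hbc₁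
        (le_trans (by have := sub_nonneg.2 hx.2; gcongr) ht) fun y hy => ?_
      have hyL : y ∈ Icc 0 L := ⟨hx.1.trans hy.1.le, hy.2.le⟩
      have hs := hspeed μ₁ hμ y (Ioo_subset_Icc_self hy)
      have hξL : ∀ ξ ∈ Icc y L, ξ ∈ Icc 0 L := fun ξ hξ => ⟨hyL.1.trans hξ.1, hξ.2⟩
      have hy' := left_mem_Icc.2 hyL.2
      rw [hpde₁ y hyL _ (le_trans (div_nonneg (sub_nonneg.2 hyL.2) hμ₂.le) (hs y hy').1)]
      refine hsource μ₁ hμ y hy _ (abs_volterra_source_le hlam hA hM hyL ((hc₁ y hyL).trans h₁)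
        (hP y hyL _ (hs y hy').1 (hs y hy').2).2
        (fun ξ hξ => (hc₁₁ (y, ξ) ⟨hyL, hξL ξ hξ⟩).trans h₁₁)
        (fun ξ hξ => (hc₁₂ (y, ξ) ⟨hyL, hξL ξ hξ⟩).trans h₁₂)
        (fun ξ hξ => (hP ξ (hξL ξ hξ) _ (hs ξ hξ).1 (hs ξ hξ).2).1)
        (fun ξ hξ => (hP ξ (hξL ξ hξ) _ (hs ξ hξ).1 (hs ξ hξ).2).2))
    · refine abs_le_exp_of_transport_source_le hμ₂ (by positivity) hx β₂ hβ₂ hbc₂ ht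
        fun y hy => ?_
      have hyL : y ∈ Icc 0 L := ⟨hx.1.trans hy.1.le, hy.2.le⟩
      have hs := hspeed μ₂ le_rfl y (Ioo_subset_Icc_self hy)
      have hξL : ∀ ξ ∈ Icc y L, ξ ∈ Icc 0 L := fun ξ hξ => ⟨hyL.1.trans hξ.1, hξ.2⟩
      have hy' := left_mem_Icc.2 hyL.2
      rw [hpde₂ y hyL _ (le_trans (div_nonneg (sub_nonneg.2 hyL.2) hμ₂.le) (hs y hy').1)]
      refine hsource μ₂ le_rfl y hy _ (abs_volterra_source_le hlam hA hM hyL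
        ((hc₂ y hyL).trans h₂)
        (hP y hyL _ (hs y hy').1 (hs y hy').2).1
        (fun ξ hξ => (hc₂₁ (y, ξ) ⟨hyL, hξL ξ hξ⟩).trans h₂₁)
        (fun ξ hξ => (hc₂₂ (y, ξ) ⟨hyL, hξL ξ hξ⟩).trans h₂₂)
        (fun ξ hξ => (hP ξ (hξL ξ hξ) _ (hs ξ hξ).1 (hs ξ hξ).2).1)
        (fun ξ hξ => (hP ξ (hξL ξ hξ) _ (hs ξ hξ).1 (hs ξ hξ).2).2))
  have hK : IsCompact (Icc (0 : ℝ) L ×ˢ Icc (0 : ℝ) T) := isCompact_Icc.prod isCompact_Icc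
  have hsub : Icc (0 : ℝ) L ×ˢ Icc (0 : ℝ) T ⊆ Icc 0 L ×ˢ Ici 0 :=
    prod_mono subset_rfl Icc_subset_Ici_self
  obtain ⟨m₁, hm₁⟩ := hK.exists_bound_of_continuousOn (hβ₁.continuousOn.mono hsub)
  obtain ⟨m₂, hm₂⟩ := hK.exists_bound_of_continuousOn (hβ₂.continuousOn.mono hsub)
  set M := max (max m₁ m₂) 0
  have hM : 0 ≤ M := le_max_right _ _
  have hbase : P M := by
    intro x hx t ht htT
    have hmem : (x, t) ∈ Icc (0 : ℝ) L ×ˢ Icc (0 : ℝ) T :=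
      ⟨hx, (div_nonneg (sub_nonneg.2 hx.2) hμ₂.le).trans ht, htT⟩
    have hexp : 1 ≤ Real.exp (lam * (L - x)) :=
      Real.one_le_exp (mul_nonneg hlam (sub_nonneg.2 hx.2))
    have hME : M ≤ M * Real.exp (lam * (L - x)) := le_mul_of_one_le_right hM hexp
    exact ⟨(hm₁ _ hmem).trans (((le_max_left _ _).trans (le_max_left _ _)).trans hME),
      (hm₂ _ hmem).trans (((le_max_right _ _).trans (le_max_left _ _)).trans hME)⟩
  have hiter : ∀ n : ℕ, P (M * (1 / 2) ^ n) := by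
    intro n
    induction n with
    | zero => simpa using hbase
    | succ n ih =>
      have := hhalf _ (by positivity) ih
      rwa [pow_succ, ← mul_assoc, mul_one_div]
  have hlim : Filter.Tendsto (fun n : ℕ => M * (1 / 2) ^ n * Real.exp (lam * (L - x₀)))
      Filter.atTop (nhds 0) := by
    simpa using ((tendsto_pow_atTop_nhds_zero_of_lt_one (r := (1 / 2 : ℝ)) (by norm_num)
      (by norm_num)).const_mul M).mul_const (Real.exp (lam * (L - x₀)))
  exact ⟨abs_nonpos_iff.1 (ge_of_tendsto' hlim fun n => (hiter n x₀ hx₀ T hT le_rfl).1),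
    abs_nonpos_iff.1 (ge_of_tendsto' hlim fun n => (hiter n x₀ hx₀ T hT le_rfl).2)⟩
end

section
/- Finite-time extinction of a coupled 2×2 rightward hyperbolic system with Volterra-type in-domain coupling and eventually zero inflow: let L > 0, 0 < ε₁ ≤ ε₂, T ≥ 0, let a_{ij} : [0,L] → ℝ and b_{ij} : [0,L]² → ℝ (i,j ∈ {1,2}) be continuous, and let α₁, α₂ be C¹ on [0,L] × [0,∞) satisfying, for all x ∈ [0,L], t ≥ 0: ∂_t α₁ + ε₁ ∂_x α₁ = a₁₁(x)α₁ + a₁₂(x)α₂ + ∫₀ˣ (b₁₁(x,ξ)α₁(ξ,t) + b₁₂(x,ξ)α₂(ξ,t)) dξ and ∂_t α₂ + ε₂ ∂_x α₂ = a₂₁(x)α₁ + a₂₂(x)α₂ + ∫₀ˣ (b₂₁(x,ξ)α₁(ξ,t) + b₂₂(x,ξ)α₂(ξ,t)) dξ, with α₁(0,t) = α₂(0,t) = 0 for all t ≥ T. Then α₁(x,t) = α₂(x,t) = 0 for every x ∈ [0,L] and every t ≥ T + x/ε₁. -/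
open Topology in
/-- A solution of a transport equation that vanishes at the foot of a characteristic is bounded by
`M * exp (lam * x)` as soon as its source is bounded by the derivative of this function along the
characteristic. -/
theorem abs_le_mul_exp_of_transport {α : ℝ → ℝ → ℝ} {L ε M lam x t : ℝ}
    (hα : ContDiffOn ℝ 1 (Function.uncurry α) (Set.Icc 0 L ×ˢ Set.Ici 0))
    (hε : 0 < ε) (hM : 0 ≤ M) (hx : 0 ≤ x) (hxL : x ≤ L) (ht : x / ε ≤ t)
    (h0 : α 0 (t - x / ε) = 0)
    (hF : ∀ s ∈ Set.Ioo 0 x, |deriv (fun τ => α s τ) (t - (x - s) / ε)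
      + ε * deriv (fun y => α y (t - (x - s) / ε)) s| ≤ ε * (lam * M * Real.exp (lam * s))) :
    |α x t| ≤ M * Real.exp (lam * x) := by
  have htime : ∀ s : ℝ, 0 ≤ s → s / ε ≤ t - (x - s) / ε := fun s _ => by
    rw [sub_div]; linarith
  have hcont : ContinuousOn (fun s => α s (t - (x - s) / ε)) (Set.Icc 0 x) := by
    refine hα.continuousOn.comp (f := fun s : ℝ => (s, t - (x - s) / ε))
      (by fun_prop) fun s hs => ⟨⟨hs.1, hs.2.trans hxL⟩, ?_⟩
    exact (div_nonneg hs.1 hε.le).trans (htime s hs.1)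
  have hder : ∀ s ∈ Set.Ioo 0 x, ∃ d, HasDerivAt (fun s => α s (t - (x - s) / ε)) d s ∧
      |d| ≤ lam * M * Real.exp (lam * s) := by
    intro s hs
    have hτ : 0 < t - (x - s) / ε := (div_pos hs.1 hε).trans_le (htime s hs.1.le)
    have hnhds : Set.Icc 0 L ×ˢ Set.Ici 0 ∈ 𝓝 (s, t - (x - s) / ε) :=
      prod_mem_nhds (Icc_mem_nhds hs.1 (hs.2.trans_le hxL)) (Ici_mem_nhds hτ)
    have hd := ((hα.contDiffAt hnhds).differentiableAt one_ne_zero).hasFDerivAt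
    set D := fderiv ℝ (Function.uncurry α) (s, t - (x - s) / ε)
    have h1 : HasDerivAt (fun τ => α s τ) (D (0, 1)) (t - (x - s) / ε) :=
      hd.comp_hasDerivAt (f := fun τ => (s, τ)) _
        ((hasDerivAt_const _ s).prodMk (hasDerivAt_id _))
    have h2 : HasDerivAt (fun y => α y (t - (x - s) / ε)) (D (1, 0)) s :=
      hd.comp_hasDerivAt (f := fun y => (y, t - (x - s) / ε)) s
        ((hasDerivAt_id s).prodMk (hasDerivAt_const s _))
    have hline : HasDerivAt (fun s => t - (x - s) / ε) (1 / ε) s := by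
      have := (((hasDerivAt_id s).const_sub x).div_const ε).const_sub t
      refine this.congr_deriv ?_
      rw [neg_div, neg_neg]
    have h3 : HasDerivAt (fun s => α s (t - (x - s) / ε)) (D (1, 1 / ε)) s :=
      hd.comp_hasDerivAt (f := fun s => (s, t - (x - s) / ε)) s
        ((hasDerivAt_id s).prodMk hline)
    refine ⟨_, h3, ?_⟩
    have hF' := hF s hs
    rw [h1.deriv, h2.deriv] at hF'
    have hsplit : ε * D (1, 1 / ε) = D (0, 1) + ε * D (1, 0) := by
      have : ((1, 1 / ε) : ℝ × ℝ) = (1, 0) + (1 / ε) • (0, 1) := by simp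
      rw [this, map_add, map_smul, smul_eq_mul]
      field_simp
      ring
    rw [← hsplit, abs_mul, abs_of_pos hε] at hF'
    exact le_of_mul_le_mul_left hF' hε
  have hexp : ∀ s : ℝ, HasDerivAt (fun s => M * Real.exp (lam * s))
      (lam * M * Real.exp (lam * s)) s := fun s => by
    have := (((hasDerivAt_id s).const_mul lam).exp).const_mul M
    refine this.congr_deriv ?_
    rw [id]
    ring
  have hexpc : ContinuousOn (fun s => M * Real.exp (lam * s)) (Set.Icc 0 x) := by fun_prop
  have hmono (σ : ℝ) (hσ : |σ| = 1) : σ * α x t ≤ M * Real.exp (lam * x) := by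
    have := monotoneOn_of_deriv_nonneg (convex_Icc 0 x)
      (f := fun s => M * Real.exp (lam * s) - σ * α s (t - (x - s) / ε))
      (hexpc.sub (continuousOn_const.mul hcont))
      (fun s hs => by
        rw [interior_Icc] at hs
        obtain ⟨d, hd, -⟩ := hder s hs
        exact ((hexp s).sub (hd.const_mul σ)).differentiableAt.differentiableWithinAt)
      (fun s hs => by
        rw [interior_Icc] at hs
        obtain ⟨d, hd, hle⟩ := hder s hs
        refine (sub_nonneg.2 ?_).trans_eq ((hexp s).sub (hd.const_mul σ)).deriv.symm
        refine (le_abs_self _).trans ?_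
        rwa [abs_mul, hσ, one_mul])
      (Set.left_mem_Icc.2 hx) (Set.right_mem_Icc.2 hx) hx
    simp only [sub_zero, sub_self, zero_div, h0, mul_zero, Real.exp_zero, mul_one] at this
    linarith
  exact abs_le.2 ⟨by linarith [hmono (-1) (by simp)], by linarith [hmono 1 (by simp)]⟩

/-- Pointwise bound for a source made of zeroth-order and Volterra terms. -/
theorem abs_volterra_source_le_s14 {A B L m lam s u v p q : ℝ} {b c f g : ℝ → ℝ}
    (hm : 0 ≤ m) (hlam : 0 ≤ lam) (hB : 0 ≤ B) (hs : 0 ≤ s) (hsL : s ≤ L)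
    (hp : |p| ≤ A) (hq : |q| ≤ A)
    (hu : |u| ≤ m * Real.exp (lam * s)) (hv : |v| ≤ m * Real.exp (lam * s))
    (hb : ∀ ξ ∈ Set.Icc 0 s, |b ξ| ≤ B) (hc : ∀ ξ ∈ Set.Icc 0 s, |c ξ| ≤ B)
    (hf : ∀ ξ ∈ Set.Icc 0 s, |f ξ| ≤ m * Real.exp (lam * ξ))
    (hg : ∀ ξ ∈ Set.Icc 0 s, |g ξ| ≤ m * Real.exp (lam * ξ)) :
    |p * u + q * v + ∫ ξ in (0:ℝ)..s, (b ξ * f ξ + c ξ * g ξ)|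
      ≤ 2 * (A + B * L) * (m * Real.exp (lam * s)) := by
  set E := m * Real.exp (lam * s)
  have hE : 0 ≤ E := by positivity
  have hA : 0 ≤ A := (abs_nonneg p).trans hp
  have hint : |∫ ξ in (0:ℝ)..s, (b ξ * f ξ + c ξ * g ξ)| ≤ (2 * (B * E)) * |s - 0| := by
    refine intervalIntegral.norm_integral_le_of_norm_le_const (E := ℝ) fun ξ hξ => ?_
    rw [Set.uIoc_of_le hs] at hξ
    have hξ' : ξ ∈ Set.Icc 0 s := ⟨hξ.1.le, hξ.2⟩
    have hle : m * Real.exp (lam * ξ) ≤ E :=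
      mul_le_mul_of_nonneg_left (Real.exp_le_exp.2 (mul_le_mul_of_nonneg_left hξ.2 hlam)) hm
    have h1 : |b ξ * f ξ| ≤ B * E := by
      rw [abs_mul]
      exact mul_le_mul (hb ξ hξ') ((hf ξ hξ').trans hle) (abs_nonneg _) hB
    have h2 : |c ξ * g ξ| ≤ B * E := by
      rw [abs_mul]
      exact mul_le_mul (hc ξ hξ') ((hg ξ hξ').trans hle) (abs_nonneg _) hB
    rw [Real.norm_eq_abs]
    linarith [abs_add_le (b ξ * f ξ) (c ξ * g ξ)]
  have hpu : |p * u| ≤ A * E := by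
    rw [abs_mul]; exact mul_le_mul hp hu (abs_nonneg _) hA
  have hqv : |q * v| ≤ A * E := by
    rw [abs_mul]; exact mul_le_mul hq hv (abs_nonneg _) hA
  rw [sub_zero, abs_of_nonneg hs] at hint
  have hBE : (2 * (B * E)) * s ≤ (2 * (B * E)) * L := by gcongr
  have := abs_add_le (p * u + q * v) (∫ ξ in (0:ℝ)..s, (b ξ * f ξ + c ξ * g ξ))
  have := abs_add_le (p * u) (q * v)
  linarith

/-- Four functions that are continuous on a compact set admit a common nonnegative bound. -/
theorem exists_common_abs_bound {X : Type*} [TopologicalSpace X] {K : Set X} (hK : IsCompact K)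
    {f₁ f₂ f₃ f₄ : X → ℝ} (h₁ : ContinuousOn f₁ K) (h₂ : ContinuousOn f₂ K)
    (h₃ : ContinuousOn f₃ K) (h₄ : ContinuousOn f₄ K) :
    ∃ C, 0 ≤ C ∧ ∀ x ∈ K, |f₁ x| ≤ C ∧ |f₂ x| ≤ C ∧ |f₃ x| ≤ C ∧ |f₄ x| ≤ C := by
  obtain ⟨C, hC⟩ := hK.exists_bound_of_continuousOn
    (((h₁.abs.add h₂.abs).add h₃.abs).add h₄.abs)
  refine ⟨max C 0, le_max_right _ _, fun x hx => ?_⟩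
  have h := (le_abs_self _).trans ((hC x hx).trans (le_max_left C 0))
  simp only [Pi.add_apply] at h
  have := abs_nonneg (f₁ x)
  have := abs_nonneg (f₂ x)
  have := abs_nonneg (f₃ x)
  have := abs_nonneg (f₄ x)
  refine ⟨?_, ?_, ?_, ?_⟩ <;> linarith


/-- Finite-time extinction of a coupled 2×2 rightward hyperbolic system with
Volterra-type in-domain coupling and eventually zero inflow: both states
vanish for t ≥ T + x/ε₁, where 0 < ε₁ ≤ ε₂ are the transport speeds. -/
theorem stmt_14
    (L ε₁ ε₂ T : ℝ) (hL : 0 < L) (hε₁ : 0 < ε₁) (hε : ε₁ ≤ ε₂) (hT : 0 ≤ T)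
    (a₁₁ a₁₂ a₂₁ a₂₂ : ℝ → ℝ) (b₁₁ b₁₂ b₂₁ b₂₂ : ℝ → ℝ → ℝ)
    (ha₁₁ : ContinuousOn a₁₁ (Set.Icc 0 L)) (ha₁₂ : ContinuousOn a₁₂ (Set.Icc 0 L))
    (ha₂₁ : ContinuousOn a₂₁ (Set.Icc 0 L)) (ha₂₂ : ContinuousOn a₂₂ (Set.Icc 0 L))
    (hb₁₁ : ContinuousOn (Function.uncurry b₁₁) (Set.Icc 0 L ×ˢ Set.Icc 0 L))
    (hb₁₂ : ContinuousOn (Function.uncurry b₁₂) (Set.Icc 0 L ×ˢ Set.Icc 0 L))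
    (hb₂₁ : ContinuousOn (Function.uncurry b₂₁) (Set.Icc 0 L ×ˢ Set.Icc 0 L))
    (hb₂₂ : ContinuousOn (Function.uncurry b₂₂) (Set.Icc 0 L ×ˢ Set.Icc 0 L))
    (α₁ α₂ : ℝ → ℝ → ℝ)
    (hα₁ : ContDiffOn ℝ 1 (Function.uncurry α₁) (Set.Icc 0 L ×ˢ Set.Ici 0))
    (hα₂ : ContDiffOn ℝ 1 (Function.uncurry α₂) (Set.Icc 0 L ×ˢ Set.Ici 0))
    (hpde₁ : ∀ x ∈ Set.Icc (0:ℝ) L, ∀ t ∈ Set.Ici (0:ℝ),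
      deriv (fun s => α₁ x s) t + ε₁ * deriv (fun y => α₁ y t) x
        = a₁₁ x * α₁ x t + a₁₂ x * α₂ x t
          + ∫ ξ in (0:ℝ)..x, (b₁₁ x ξ * α₁ ξ t + b₁₂ x ξ * α₂ ξ t))
    (hpde₂ : ∀ x ∈ Set.Icc (0:ℝ) L, ∀ t ∈ Set.Ici (0:ℝ),
      deriv (fun s => α₂ x s) t + ε₂ * deriv (fun y => α₂ y t) x
        = a₂₁ x * α₁ x t + a₂₂ x * α₂ x t
          + ∫ ξ in (0:ℝ)..x, (b₂₁ x ξ * α₁ ξ t + b₂₂ x ξ * α₂ ξ t))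
    (hbc₁ : ∀ t : ℝ, T ≤ t → α₁ 0 t = 0)
    (hbc₂ : ∀ t : ℝ, T ≤ t → α₂ 0 t = 0) :
    ∀ x ∈ Set.Icc (0:ℝ) L, ∀ t : ℝ, T + x / ε₁ ≤ t →
      α₁ x t = 0 ∧ α₂ x t = 0 := by
  intro x₀ hx₀ t₀ ht₀
  obtain ⟨A, hA, hAb⟩ := exists_common_abs_bound isCompact_Icc ha₁₁ ha₁₂ ha₂₁ ha₂₂
  obtain ⟨B, hB, hBb⟩ :=
    exists_common_abs_bound (isCompact_Icc.prod isCompact_Icc) hb₁₁ hb₁₂ hb₂₁ hb₂₂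
  have hε₂ : 0 < ε₂ := hε₁.trans_le hε
  set C := 2 * (A + B * L) with hC
  have hC0 : 0 ≤ C := by positivity
  set lam := 2 * C / ε₁ with hlam
  have hlam0 : 0 ≤ lam := by positivity
  set K : Set (ℝ × ℝ) :=
    (Set.Icc 0 L ×ˢ Set.Icc 0 t₀) ∩ {p | T + p.1 / ε₁ ≤ p.2} with hK
  have hKc : IsCompact K := (isCompact_Icc.prod isCompact_Icc).inter_right
    (isClosed_le (by fun_prop) (by fun_prop))
  have hKsub : K ⊆ Set.Icc 0 L ×ˢ Set.Ici 0 := fun p hp => ⟨hp.1.1, hp.1.2.1⟩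
  have hmem₀ : (x₀, t₀) ∈ K := by
    have : 0 ≤ x₀ / ε₁ := div_nonneg hx₀.1 hε₁.le
    exact ⟨⟨hx₀, by linarith, le_rfl⟩, ht₀⟩
  obtain ⟨p, hp, hmax⟩ := hKc.exists_isMaxOn ⟨_, hmem₀⟩
    (f := fun p : ℝ × ℝ => max |Function.uncurry α₁ p| |Function.uncurry α₂ p|
      * Real.exp (-(lam * p.1)))
    (((hα₁.continuousOn.mono hKsub).abs.sup (hα₂.continuousOn.mono hKsub).abs).mul
      (by fun_prop))
  set m := max |Function.uncurry α₁ p| |Function.uncurry α₂ p| * Real.exp (-(lam * p.1)) with hm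
  have hm0 : 0 ≤ m := by positivity
  have hbound : ∀ x t, (x, t) ∈ K →
      |α₁ x t| ≤ m * Real.exp (lam * x) ∧ |α₂ x t| ≤ m * Real.exp (lam * x) := by
    intro x t hxt
    have h : max |α₁ x t| |α₂ x t| * Real.exp (-(lam * x)) ≤ m := hmax hxt
    rw [Real.exp_neg, ← div_eq_mul_inv, div_le_iff₀ (Real.exp_pos _)] at h
    exact max_le_iff.1 h
  have hvert : ∀ {x t : ℝ}, (x, t) ∈ K → ∀ ξ ∈ Set.Icc 0 x, (ξ, t) ∈ K := by
    intro x t hxt ξ hξ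
    have h1 : T + x / ε₁ ≤ t := hxt.2
    have h2 : ξ / ε₁ ≤ x / ε₁ := div_le_div_of_nonneg_right hξ.2 hε₁.le
    exact ⟨⟨⟨hξ.1, hξ.2.trans hxt.1.1.2⟩, hxt.1.2⟩, (by linarith : T + ξ / ε₁ ≤ t)⟩
  have hchar : ∀ {ε : ℝ}, ε₁ ≤ ε → ∀ {x t : ℝ}, (x, t) ∈ K → ∀ s ∈ Set.Icc 0 x,
      (s, t - (x - s) / ε) ∈ K := by
    intro ε hle x t hxt s hs
    have h1 : T + x / ε₁ ≤ t := hxt.2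
    have h2 : (x - s) / ε ≤ (x - s) / ε₁ :=
      div_le_div_of_nonneg_left (sub_nonneg.2 hs.2) hε₁ hle
    have h3 : 0 ≤ (x - s) / ε := div_nonneg (sub_nonneg.2 hs.2) (hε₁.trans_le hle).le
    have h4 : 0 ≤ s / ε₁ := div_nonneg hs.1 hε₁.le
    have h5 : t ≤ t₀ := hxt.1.2.2
    have h6 : (x - s) / ε₁ = x / ε₁ - s / ε₁ := sub_div _ _ _
    exact ⟨⟨⟨hs.1, hs.2.trans hxt.1.1.2⟩, by linarith, by linarith⟩,
      (by linarith : T + s / ε₁ ≤ t - (x - s) / ε)⟩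
  have hspeed : ∀ {ε : ℝ}, ε₁ ≤ ε → ∀ s : ℝ,
      C * (m * Real.exp (lam * s)) ≤ ε * (lam * (m / 2) * Real.exp (lam * s)) := by
    intro ε hle s
    have h : C ≤ ε * (lam / 2) := by
      have : C = ε₁ * (lam / 2) := by rw [hlam]; field_simp
      rw [this]
      gcongr
    calc C * (m * Real.exp (lam * s)) ≤ ε * (lam / 2) * (m * Real.exp (lam * s)) := by gcongr
      _ = _ := by ring
  have himprove : ∀ {ε : ℝ}, ε₁ ≤ ε → ∀ {α : ℝ → ℝ → ℝ},
      ContDiffOn ℝ 1 (Function.uncurry α) (Set.Icc 0 L ×ˢ Set.Ici 0) →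
      (∀ t, T ≤ t → α 0 t = 0) →
      (∀ x t, (x, t) ∈ K → |deriv (fun s => α x s) t + ε * deriv (fun y => α y t) x|
        ≤ C * (m * Real.exp (lam * x))) →
      |α p.1 p.2| ≤ m / 2 * Real.exp (lam * p.1) := by
    intro ε hle α hα hbc hsrc
    have h0 := hchar hle hp 0 (Set.left_mem_Icc.2 hp.1.1.1)
    rw [sub_zero] at h0
    have hfoot : T + 0 / ε₁ ≤ p.2 - p.1 / ε := h0.2
    rw [zero_div, add_zero] at hfoot
    refine abs_le_mul_exp_of_transport hα (hε₁.trans_le hle) (by positivity) hp.1.1.1 hp.1.1.2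
      (by linarith) (hbc _ hfoot) fun s hs => ?_
    exact (hsrc _ _ (hchar hle hp s ⟨hs.1.le, hs.2.le⟩)).trans (hspeed hle s)
  have hB' : ∀ {x : ℝ}, x ∈ Set.Icc 0 L → ∀ ξ ∈ Set.Icc 0 x,
      |b₁₁ x ξ| ≤ B ∧ |b₁₂ x ξ| ≤ B ∧ |b₂₁ x ξ| ≤ B ∧ |b₂₂ x ξ| ≤ B :=
    fun {x} hx ξ hξ => hBb (x, ξ) ⟨hx, hξ.1, hξ.2.trans hx.2⟩
  have h₁ : |α₁ p.1 p.2| ≤ m / 2 * Real.exp (lam * p.1) := by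
    refine himprove le_rfl hα₁ hbc₁ fun x t hxt => ?_
    have hx : x ∈ Set.Icc 0 L := hxt.1.1
    rw [hpde₁ x hx t hxt.1.2.1]
    exact abs_volterra_source_le_s14 hm0 hlam0 hB hx.1 hx.2 (hAb x hx).1 (hAb x hx).2.1
      (hbound x t hxt).1 (hbound x t hxt).2
      (fun ξ hξ => (hB' hx ξ hξ).1) (fun ξ hξ => (hB' hx ξ hξ).2.1)
      (fun ξ hξ => (hbound ξ t (hvert hxt ξ hξ)).1)
      (fun ξ hξ => (hbound ξ t (hvert hxt ξ hξ)).2)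
  have h₂ : |α₂ p.1 p.2| ≤ m / 2 * Real.exp (lam * p.1) := by
    refine himprove hε hα₂ hbc₂ fun x t hxt => ?_
    have hx : x ∈ Set.Icc 0 L := hxt.1.1
    rw [hpde₂ x hx t hxt.1.2.1]
    exact abs_volterra_source_le_s14 hm0 hlam0 hB hx.1 hx.2 (hAb x hx).2.2.1 (hAb x hx).2.2.2
      (hbound x t hxt).1 (hbound x t hxt).2
      (fun ξ hξ => (hB' hx ξ hξ).2.2.1) (fun ξ hξ => (hB' hx ξ hξ).2.2.2)
      (fun ξ hξ => (hbound ξ t (hvert hxt ξ hξ)).1)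
      (fun ξ hξ => (hbound ξ t (hvert hxt ξ hξ)).2)
  have hm_half : m ≤ m / 2 := by
    conv_lhs => rw [hm]
    rw [Real.exp_neg, ← div_eq_mul_inv, div_le_iff₀ (Real.exp_pos _)]
    exact max_le h₁ h₂
  have hm_zero : m = 0 := by linarith
  have h := hbound x₀ t₀ hmem₀
  rw [hm_zero, zero_mul] at h
  exact ⟨abs_nonpos_iff.1 h.1, abs_nonpos_iff.1 h.2⟩
end

section
/- (Lemma 3: finite-time convergence of the observer error target system.) Let L > 0, 0 < ε₁ ≤ ε₂, μ₁ ≥ μ₂ > 0, k_s, k_f ∈ ℝ; let a₁, a₂, h₁, h₂, λ : [0,L] → ℝ, g_{ij} : [0,L] → ℝ and d_{ij}, f_{ij} : [0,L]² → ℝ (i,j ∈ {1,2}) be continuous. Suppose α_s, α_f, β_s, β_f are C¹ on [0,L] × [0,∞) and satisfy, for all x ∈ [0,L], t ≥ 0: ∂_t α_s + ε₁ ∂_x α_s = a₁(x)α_s + g₁₁(x)β_s + g₁₂(x)β_f + ∫ₓᴸ (d₁₁(x,ξ)β_s(ξ,t) + d₁₂(x,ξ)β_f(ξ,t)) dξ;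 ∂_t α_f + ε₂ ∂_x α_f = a₂(x)α_f + g₂₁(x)β_s + g₂₂(x)β_f + ∫ₓᴸ (d₂₁(x,ξ)β_s(ξ,t) + d₂₂(x,ξ)β_f(ξ,t)) dξ; ∂_t β_s − μ₁ ∂_x β_s = h₁(x)β_f + ∫ₓᴸ (f₁₁(x,ξ)β_s(ξ,t) + f₁₂(x,ξ)β_f(ξ,t)) dξ; ∂_t β_f − μ₂ ∂_x β_f = h₂(x)β_s + ∫ₓᴸ (f₂₁(x,ξ)β_s(ξ,t) + f₂₂(x,ξ)β_f(ξ,t)) dξ; with boundary conditions α_s(0,t) = k_s β_s(0,t), α_f(0,t) = k_f β_f(0,t) − ∫₀ᴸ λ(x)α_s(x,t) dx, β_s(L,t) = 0, β_f(L,t) = 0 for all t ≥ 0. Then α_s(x,t) = α_f(x,t) = β_s(x,t) = β_f(x,t) = 0 for all x ∈ [0,L] and all t ≥ t_o, where t_o := L/ε₁ + L/ε₂ + L/μ₂. -/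
open Set

/-- A quantity vanishing initially whose derivative is bounded by an exponential
is bounded by the integral of that exponential. -/
lemma abs_le_of_abs_deriv_le_exp {w w' : ℝ → ℝ} {S A κ : ℝ} (hS : 0 ≤ S) (hA : 0 ≤ A)
    (hκ : 0 < κ) (hw : ContinuousOn w (Icc 0 S))
    (hd : ∀ s ∈ Ioo 0 S, HasDerivAt w (w' s) s) (h0 : w 0 = 0)
    (hb : ∀ s ∈ Ioo 0 S, |w' s| ≤ A * Real.exp (κ * s)) :
    |w S| ≤ A / κ * Real.exp (κ * S) := by
  have hexp (s : ℝ) :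
      HasDerivAt (fun s => A / κ * Real.exp (κ * s)) (A * Real.exp (κ * s)) s := by
    have h := (((hasDerivAt_id s).const_mul κ).exp).const_mul (A / κ)
    refine h.congr_deriv ?_
    simp only [id]
    field_simp
  have key (v v' : ℝ → ℝ) (hv : ContinuousOn v (Icc 0 S))
      (hvd : ∀ s ∈ Ioo 0 S, HasDerivAt v (v' s) s) (hv0 : v 0 = 0)
      (hvb : ∀ s ∈ Ioo 0 S, v' s ≤ A * Real.exp (κ * s)) :
      v S ≤ A / κ * Real.exp (κ * S) := by
    have hmono : MonotoneOn (fun s => A / κ * Real.exp (κ * s) - v s) (Icc 0 S) := by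
      refine monotoneOn_of_hasDerivWithinAt_nonneg
        (f' := fun s => A * Real.exp (κ * s) - v' s) (convex_Icc 0 S) ?_ ?_ ?_
      · exact ContinuousOn.sub (by fun_prop) hv
      · intro s hs
        rw [interior_Icc] at hs
        exact ((hexp s).sub (hvd s hs)).hasDerivWithinAt
      · intro s hs
        rw [interior_Icc] at hs
        exact sub_nonneg.2 (hvb s hs)
    have h := hmono (left_mem_Icc.2 hS) (right_mem_Icc.2 hS) hS
    simp only [mul_zero, Real.exp_zero, mul_one, hv0, sub_zero] at h
    have : 0 ≤ A / κ := by positivity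
    linarith
  refine abs_le'.2 ⟨key w w' hw hd h0 fun s hs => (le_abs_self _).trans (hb s hs),
    key (fun s => -w s) (fun s => -w' s) hw.neg (fun s hs => (hd s hs).neg) (by simp [h0])
      fun s hs => (neg_le_abs _).trans (hb s hs)⟩

/-- A solution of a scalar linear differential inequality with zero initial value vanishes. -/
lemma eq_zero_of_abs_deriv_le {w w' : ℝ → ℝ} {S C : ℝ} (hS : 0 ≤ S) (hC : 0 ≤ C)
    (hw : ContinuousOn w (Icc 0 S)) (hd : ∀ s ∈ Ioo 0 S, HasDerivAt w (w' s) s)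
    (h0 : w 0 = 0) (hb : ∀ s ∈ Ioo 0 S, |w' s| ≤ C * |w s|) : w S = 0 := by
  have hκ : 0 < C + 1 := by linarith
  obtain ⟨r, hr, hmax⟩ := isCompact_Icc.exists_isMaxOn (nonempty_Icc.2 hS)
    (f := fun s => |w s| * Real.exp (-((C + 1) * s)))
    (hw.abs.mul (by fun_prop))
  set N := |w r| * Real.exp (-((C + 1) * r)) with hN
  have hN0 : 0 ≤ N := by positivity
  have hle : ∀ s ∈ Icc 0 S, |w s| ≤ N * Real.exp ((C + 1) * s) := fun s hs => by
    have h : |w s| * Real.exp (-((C + 1) * s)) ≤ N := hmax hs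
    rwa [Real.exp_neg, mul_inv_le_iff₀ (Real.exp_pos _)] at h
  have h := abs_le_of_abs_deriv_le_exp (A := C * N) hr.1 (by positivity) hκ
    (hw.mono (Icc_subset_Icc_right hr.2)) (fun s hs => hd s ⟨hs.1, hs.2.trans_le hr.2⟩) h0
    (fun s hs => by
      have hs' : s ∈ Ioo 0 S := ⟨hs.1, hs.2.trans_le hr.2⟩
      calc |w' s| ≤ C * |w s| := hb s hs'
        _ ≤ C * (N * Real.exp ((C + 1) * s)) := by gcongr; exact hle s (Ioo_subset_Icc_self hs')
        _ = _ := by ring)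
  have h' : N ≤ C * N / (C + 1) := by
    have h := mul_le_mul_of_nonneg_right h (Real.exp_pos (-((C + 1) * r))).le
    simpa [mul_assoc, ← Real.exp_add] using h
  have hNz : N = 0 := by
    rw [le_div_iff₀ hκ] at h'
    linarith
  simpa [hNz] using hle S (right_mem_Icc.2 hS)

section Transport

variable {L : ℝ} {u : ℝ → ℝ → ℝ}

/-- Derivative of a `C¹` function along a characteristic line of speed `c`. -/
lemma hasDerivAt_along_characteristic_s16
    (hu : ContDiffOn ℝ 1 (Function.uncurry u) (Icc 0 L ×ˢ Ici 0)) (c x₀ t₀ s : ℝ)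
    (hx : x₀ + c * s ∈ Ioo 0 L) (ht : 0 < t₀ + s) :
    HasDerivAt (fun s => u (x₀ + c * s) (t₀ + s))
      (deriv (fun r => u (x₀ + c * s) r) (t₀ + s)
        + c * deriv (fun y => u y (t₀ + s)) (x₀ + c * s)) s := by
  have hmem : Icc 0 L ×ˢ Ici 0 ∈ nhds (x₀ + c * s, t₀ + s) :=
    prod_mem_nhds (Icc_mem_nhds hx.1 hx.2) (Ici_mem_nhds ht)
  have hF := ((hu.contDiffAt hmem).differentiableAt (by norm_num)).hasFDerivAt
  set F := fderiv ℝ (Function.uncurry u) (x₀ + c * s, t₀ + s)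
  have h1 : HasDerivAt (fun r => u (x₀ + c * s) r) (F (0, 1)) (t₀ + s) := by
    have hl : HasDerivAt (fun r => (x₀ + c * s, r)) ((0 : ℝ), (1 : ℝ)) (t₀ + s) :=
      (hasDerivAt_const _ _).prodMk (hasDerivAt_id _)
    exact hF.comp_hasDerivAt (t₀ + s) hl
  have h2 : HasDerivAt (fun y => u y (t₀ + s)) (F (1, 0)) (x₀ + c * s) := by
    have hl : HasDerivAt (fun y => (y, t₀ + s)) ((1 : ℝ), (0 : ℝ)) (x₀ + c * s) :=
      (hasDerivAt_id _).prodMk (hasDerivAt_const _ _)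
    exact hF.comp_hasDerivAt (x₀ + c * s) hl
  have h3 : HasDerivAt (fun s => u (x₀ + c * s) (t₀ + s)) (F (c, 1)) s := by
    have hl : HasDerivAt (fun s => (x₀ + c * s, t₀ + s)) (c, (1 : ℝ)) s := by
      have ha : HasDerivAt (fun s => x₀ + c * s) c s := by
        simpa using ((hasDerivAt_id s).const_mul c).const_add x₀
      have hb : HasDerivAt (fun s => t₀ + s) 1 s := (hasDerivAt_id s).const_add t₀
      exact ha.prodMk hb
    exact hF.comp_hasDerivAt s hl
  rw [h1.deriv, h2.deriv]
  convert h3 using 1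
  have : ((c, 1) : ℝ × ℝ) = (0, 1) + c • (1, 0) := by simp
  rw [this, map_add, map_smul, smul_eq_mul]

lemma continuousOn_along_characteristic
    (hu : ContDiffOn ℝ 1 (Function.uncurry u) (Icc 0 L ×ˢ Ici 0)) {c x₀ t₀ : ℝ} {I : Set ℝ}
    (hx : ∀ s ∈ I, x₀ + c * s ∈ Icc 0 L) (ht : ∀ s ∈ I, 0 ≤ t₀ + s) :
    ContinuousOn (fun s => u (x₀ + c * s) (t₀ + s)) I :=
  hu.continuousOn.comp (f := fun s => (x₀ + c * s, t₀ + s)) (by fun_prop)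
    fun s hs => ⟨hx s hs, ht s hs⟩

/-- A right-going transport equation with zero inflow after time `τ` has zero solution
once the inflow has travelled through the domain. -/
lemma transport_eq_zero
    (hu : ContDiffOn ℝ 1 (Function.uncurry u) (Icc 0 L ×ˢ Ici 0)) {c τ : ℝ} (hc : 0 < c)
    (hτ : 0 ≤ τ) {a : ℝ → ℝ} (ha : ContinuousOn a (Icc 0 L))
    (hpde : ∀ x ∈ Ioo 0 L, ∀ t, τ ≤ t →
      deriv (fun s => u x s) t + c * deriv (fun y => u y t) x = a x * u x t)
    (hbc : ∀ t, τ ≤ t → u 0 t = 0) :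
    ∀ x ∈ Icc 0 L, ∀ t, τ + x / c ≤ t → u x t = 0 := by
  intro x hx t ht
  obtain ⟨C, hC⟩ := isCompact_Icc.exists_bound_of_continuousOn ha
  have hC0 : 0 ≤ C := (norm_nonneg _).trans (hC x hx)
  have hS : 0 ≤ x / c := div_nonneg hx.1 hc.le
  have hcx : c * (x / c) = x := by field_simp
  have hpos : ∀ s ∈ Icc 0 (x / c), 0 + c * s ∈ Icc 0 L := fun s hs => by
    have := mul_le_mul_of_nonneg_left hs.2 hc.le
    have := mul_nonneg hc.le hs.1
    constructor <;> linarith [hx.2]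
  have hpos' : ∀ s ∈ Ioo 0 (x / c), 0 + c * s ∈ Ioo 0 L := fun s hs => by
    have := mul_lt_mul_of_pos_left hs.2 hc
    have := mul_pos hc hs.1
    constructor <;> linarith [hx.2]
  have h := eq_zero_of_abs_deriv_le hS hC0
    (continuousOn_along_characteristic hu (t₀ := t - x / c) hpos
      fun s hs => by linarith [hs.1])
    (fun s hs => hasDerivAt_along_characteristic_s16 hu c 0 (t - x / c) s (hpos' s hs)
      (by linarith [hs.1]))
    (by simpa using hbc (t - x / c) (by linarith))
    (fun s hs => by
      rw [hpde _ (hpos' s hs) _ (by linarith [hs.1]), abs_mul]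
      exact mul_le_mul_of_nonneg_right (hC _ (Ioo_subset_Icc_self (hpos' s hs))) (abs_nonneg _))
  simpa [hcx] using h

/-- Weighted estimate for a left-going transport equation with zero inflow at `x = L`,
on the domain of determinacy of a possibly slower speed `ν`. -/
lemma transport_abs_le
    (hu : ContDiffOn ℝ 1 (Function.uncurry u) (Icc 0 L ×ˢ Ici 0)) {μ ν T A κ : ℝ} (hν : 0 < ν)
    (hνμ : ν ≤ μ) (hA : 0 ≤ A) (hκ : 0 < κ) (hbc : ∀ t, 0 ≤ t → u L t = 0)
    (hpde : ∀ x ∈ Ioo 0 L, ∀ t ∈ Icc ((L - x) / ν) T,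
      |deriv (fun s => u x s) t - μ * deriv (fun y => u y t) x| ≤ A * Real.exp (κ * (L - x))) :
    ∀ x ∈ Icc 0 L, ∀ t ∈ Icc ((L - x) / ν) T,
      |u x t| ≤ A / (κ * ν) * Real.exp (κ * (L - x)) := by
  intro x hx t ht
  have hμ : 0 < μ := hν.trans_le hνμ
  have hS : 0 ≤ (L - x) / μ := div_nonneg (by linarith [hx.2]) hμ.le
  have hcx : μ * ((L - x) / μ) = L - x := by field_simp
  have htime : ∀ s ∈ Icc 0 ((L - x) / μ),
      (L - (L + -μ * s)) / ν ≤ t - (L - x) / μ + s := fun s hs => by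
    have h1 : μ * s ≤ L - x := hcx ▸ mul_le_mul_of_nonneg_left hs.2 hμ.le
    have h2 : (L - x - μ * s) / μ ≤ (L - x - μ * s) / ν :=
      div_le_div_of_nonneg_left (by linarith) hν hνμ
    have h3 : (L - x - μ * s) / μ = (L - x) / μ - s := by field_simp
    have h4 : (L - (L + -μ * s)) / ν = (L - x) / ν - (L - x - μ * s) / ν := by ring
    linarith [ht.1]
  have hpos : ∀ s ∈ Icc 0 ((L - x) / μ), L + -μ * s ∈ Icc 0 L := fun s hs => by
    have := mul_le_mul_of_nonneg_left hs.2 hμ.le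
    have := mul_nonneg hμ.le hs.1
    constructor <;> linarith [hx.1]
  have hpos' : ∀ s ∈ Ioo 0 ((L - x) / μ), L + -μ * s ∈ Ioo 0 L := fun s hs => by
    have := mul_lt_mul_of_pos_left hs.2 hμ
    have := mul_pos hμ hs.1
    constructor <;> linarith [hx.1]
  have hstart : 0 ≤ t - (L - x) / μ := by simpa using htime 0 ⟨le_rfl, hS⟩
  have h := abs_le_of_abs_deriv_le_exp hS hA (mul_pos hκ hμ)
    (continuousOn_along_characteristic hu (t₀ := t - (L - x) / μ) hpos
      fun s hs => by linarith [hs.1])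
    (fun s hs => hasDerivAt_along_characteristic_s16 hu (-μ) L (t - (L - x) / μ) s (hpos' s hs)
      (by linarith [hs.1]))
    (by simpa using hbc _ hstart)
    (fun s hs => by
      have h := hpde _ (hpos' s hs) (t - (L - x) / μ + s)
        ⟨htime s (Ioo_subset_Icc_self hs), by linarith [ht.2, hs.2]⟩
      convert h using 2
      · ring
      · congr 1; ring)
  have hx' : L + -μ * ((L - x) / μ) = x := by linarith
  rw [hx', sub_add_cancel, mul_assoc, hcx] at h
  refine h.trans ?_
  gcongr

end Transport

/-- Pointwise bound for a source consisting of a local term and a Volterra integral term. -/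
lemma abs_source_le {L H F N κ x : ℝ} {η : ℝ} {k₁ k₂ b₁ b₂ : ℝ → ℝ} {b : ℝ} (hx : x ∈ Icc 0 L)
    (hN : 0 ≤ N) (hκ : 0 ≤ κ) (hη : |η| ≤ H) (hk₁ : ∀ ξ ∈ Icc x L, |k₁ ξ| ≤ F)
    (hk₂ : ∀ ξ ∈ Icc x L, |k₂ ξ| ≤ F) (hb : |b| ≤ N * Real.exp (κ * (L - x)))
    (hb₁ : ∀ ξ ∈ Icc x L, |b₁ ξ| ≤ N * Real.exp (κ * (L - ξ)))
    (hb₂ : ∀ ξ ∈ Icc x L, |b₂ ξ| ≤ N * Real.exp (κ * (L - ξ))) :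
    |η * b + ∫ ξ in x..L, (k₁ ξ * b₁ ξ + k₂ ξ * b₂ ξ)|
      ≤ (H + 2 * F * L) * N * Real.exp (κ * (L - x)) := by
  set E := N * Real.exp (κ * (L - x)) with hE
  have hE0 : 0 ≤ E := by positivity
  have hF : 0 ≤ F := (abs_nonneg _).trans (hk₁ x ⟨le_rfl, hx.2⟩)
  have hint : ‖∫ ξ in x..L, (k₁ ξ * b₁ ξ + k₂ ξ * b₂ ξ)‖ ≤ (F * E + F * E) * |L - x| := by
    refine intervalIntegral.norm_integral_le_of_norm_le_const fun ξ hξ => ?_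
    rw [uIoc_of_le hx.2] at hξ
    have hξ' : ξ ∈ Icc x L := Ioc_subset_Icc_self hξ
    have hEξ : N * Real.exp (κ * (L - ξ)) ≤ E := by
      rw [hE]
      have := hξ'.1
      gcongr
    refine (abs_add_le _ _).trans ?_
    rw [abs_mul, abs_mul]
    exact add_le_add
      (mul_le_mul (hk₁ ξ hξ') ((hb₁ ξ hξ').trans hEξ) (abs_nonneg _) hF)
      (mul_le_mul (hk₂ ξ hξ') ((hb₂ ξ hξ').trans hEξ) (abs_nonneg _) hF)
  have hlen : (F * E + F * E) * |L - x| ≤ (F * E + F * E) * L := by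
    rw [abs_of_nonneg (by linarith [hx.2])]
    gcongr
    linarith [hx.1]
  calc _ ≤ |η * b| + |∫ ξ in x..L, (k₁ ξ * b₁ ξ + k₂ ξ * b₂ ξ)| := abs_add_le _ _
    _ ≤ H * E + (F * E + F * E) * L := by
      refine add_le_add ?_ (hint.trans hlen)
      rw [abs_mul]
      exact mul_le_mul hη hb (abs_nonneg _) ((abs_nonneg _).trans hη)
    _ = _ := by rw [hE]; ring

/-- The left-going subsystem with zero inflow at `x = L` vanishes on the domain of
determinacy of the slower speed. -/
lemma left_going_system_eq_zero {L μ₁ μ₂ : ℝ} (hL : 0 < L) (hμ₂ : 0 < μ₂) (hμ : μ₂ ≤ μ₁)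
    {h₁ h₂ : ℝ → ℝ} {f₁₁ f₁₂ f₂₁ f₂₂ : ℝ → ℝ → ℝ}
    (hh₁ : ContinuousOn h₁ (Icc 0 L)) (hh₂ : ContinuousOn h₂ (Icc 0 L))
    (hf₁₁ : ContinuousOn (Function.uncurry f₁₁) (Icc 0 L ×ˢ Icc 0 L))
    (hf₁₂ : ContinuousOn (Function.uncurry f₁₂) (Icc 0 L ×ˢ Icc 0 L))
    (hf₂₁ : ContinuousOn (Function.uncurry f₂₁) (Icc 0 L ×ˢ Icc 0 L))
    (hf₂₂ : ContinuousOn (Function.uncurry f₂₂) (Icc 0 L ×ˢ Icc 0 L))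
    {v w : ℝ → ℝ → ℝ}
    (hv : ContDiffOn ℝ 1 (Function.uncurry v) (Icc 0 L ×ˢ Ici 0))
    (hw : ContDiffOn ℝ 1 (Function.uncurry w) (Icc 0 L ×ˢ Ici 0))
    (hpde_v : ∀ x ∈ Icc (0:ℝ) L, ∀ t ∈ Ici (0:ℝ),
      deriv (fun s => v x s) t - μ₁ * deriv (fun y => v y t) x
        = h₁ x * w x t + ∫ ξ in x..L, (f₁₁ x ξ * v ξ t + f₁₂ x ξ * w ξ t))
    (hpde_w : ∀ x ∈ Icc (0:ℝ) L, ∀ t ∈ Ici (0:ℝ),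
      deriv (fun s => w x s) t - μ₂ * deriv (fun y => w y t) x
        = h₂ x * v x t + ∫ ξ in x..L, (f₂₁ x ξ * v ξ t + f₂₂ x ξ * w ξ t))
    (hbc_v : ∀ t ∈ Ici (0:ℝ), v L t = 0) (hbc_w : ∀ t ∈ Ici (0:ℝ), w L t = 0) :
    ∀ x ∈ Icc (0:ℝ) L, ∀ t : ℝ, (L - x) / μ₂ ≤ t → v x t = 0 ∧ w x t = 0 := by
  intro x₁ hx₁ T hT
  obtain ⟨H₁, hH₁⟩ := isCompact_Icc.exists_bound_of_continuousOn hh₁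
  obtain ⟨H₂, hH₂⟩ := isCompact_Icc.exists_bound_of_continuousOn hh₂
  have hsq : IsCompact (Icc (0:ℝ) L ×ˢ Icc (0:ℝ) L) := isCompact_Icc.prod isCompact_Icc
  obtain ⟨F₁₁, hF₁₁⟩ := hsq.exists_bound_of_continuousOn hf₁₁
  obtain ⟨F₁₂, hF₁₂⟩ := hsq.exists_bound_of_continuousOn hf₁₂
  obtain ⟨F₂₁, hF₂₁⟩ := hsq.exists_bound_of_continuousOn hf₂₁
  obtain ⟨F₂₂, hF₂₂⟩ := hsq.exists_bound_of_continuousOn hf₂₂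
  set H := max H₁ H₂
  set F := max (max F₁₁ F₁₂) (max F₂₁ F₂₂)
  have hH0 : 0 ≤ H := ((norm_nonneg _).trans (hH₁ x₁ hx₁)).trans (le_max_left _ _)
  have hF0 : 0 ≤ F := ((norm_nonneg _).trans (hF₁₁ (x₁, x₁) ⟨hx₁, hx₁⟩)).trans
    ((le_max_left _ _).trans (le_max_left _ _))
  set C := H + 2 * F * L
  have hC0 : 0 ≤ C := by positivity
  set κ := (2 * C + 1) / μ₂ with hκ_def
  have hκ : 0 < κ := by positivity
  have hκμ : κ * μ₂ = 2 * C + 1 := by rw [hκ_def]; field_simp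
  set K : Set (ℝ × ℝ) := (Icc 0 L ×ˢ Icc 0 T) ∩ {p | (L - p.1) / μ₂ ≤ p.2}
  have hK : IsCompact K := (isCompact_Icc.prod isCompact_Icc).inter_right
    (isClosed_le (by fun_prop) (by fun_prop))
  have hmemK : ∀ x ∈ Icc 0 L, ∀ t ∈ Icc ((L - x) / μ₂) T, (x, t) ∈ K := fun x hx t ht =>
    ⟨⟨hx, (div_nonneg (sub_nonneg.2 hx.2) hμ₂.le).trans ht.1, ht.2⟩, ht.1⟩
  have hKsub : K ⊆ Icc 0 L ×ˢ Ici 0 := fun p hp => ⟨hp.1.1, hp.1.2.1⟩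
  obtain ⟨⟨x₀, t₀⟩, hp, hmax⟩ := hK.exists_isMaxOn ⟨_, hmemK x₁ hx₁ T ⟨hT, le_rfl⟩⟩
    (f := fun p => (|Function.uncurry v p| + |Function.uncurry w p|)
      * Real.exp (-(κ * (L - p.1))))
    (((hv.continuousOn.mono hKsub).abs.add (hw.continuousOn.mono hKsub).abs).mul (by fun_prop))
  set N := (|v x₀ t₀| + |w x₀ t₀|) * Real.exp (-(κ * (L - x₀))) with hN
  have hN0 : 0 ≤ N := by positivity
  have hsum : ∀ x ∈ Icc 0 L, ∀ t ∈ Icc ((L - x) / μ₂) T,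
      |v x t| + |w x t| ≤ N * Real.exp (κ * (L - x)) := fun x hx t ht => by
    have h : (|v x t| + |w x t|) * Real.exp (-(κ * (L - x))) ≤ N := hmax (hmemK x hx t ht)
    rwa [Real.exp_neg, mul_inv_le_iff₀ (Real.exp_pos _)] at h
  have hvle : ∀ x ∈ Icc 0 L, ∀ t ∈ Icc ((L - x) / μ₂) T,
      |v x t| ≤ N * Real.exp (κ * (L - x)) := fun x hx t ht => by
    linarith [hsum x hx t ht, abs_nonneg (w x t)]
  have hwle : ∀ x ∈ Icc 0 L, ∀ t ∈ Icc ((L - x) / μ₂) T,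
      |w x t| ≤ N * Real.exp (κ * (L - x)) := fun x hx t ht => by
    linarith [hsum x hx t ht, abs_nonneg (v x t)]
  have htime {x t : ℝ} (ht : t ∈ Icc ((L - x) / μ₂) T) {ξ : ℝ} (hξ : ξ ∈ Icc x L) :
      t ∈ Icc ((L - ξ) / μ₂) T := by
    refine ⟨le_trans ?_ ht.1, ht.2⟩
    have := hξ.1
    gcongr
  have hsub {x : ℝ} (hx : x ∈ Icc 0 L) {ξ : ℝ} (hξ : ξ ∈ Icc x L) : ξ ∈ Icc 0 L :=
    ⟨hx.1.trans hξ.1, hξ.2⟩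
  have hx₀ : x₀ ∈ Icc 0 L := hp.1.1
  have ht₀ : t₀ ∈ Icc ((L - x₀) / μ₂) T := ⟨hp.2, hp.1.2.2⟩
  have hv₀ := transport_abs_le hv (T := T) hμ₂ hμ (mul_nonneg hC0 hN0) hκ hbc_v
    (fun x hx t ht => by
      have hx' := Ioo_subset_Icc_self hx
      rw [hpde_v x hx' t (hKsub (hmemK x hx' t ht)).2]
      exact abs_source_le hx' hN0 hκ.le ((hH₁ x hx').trans (le_max_left _ _))
        (fun ξ hξ => (hF₁₁ (x, ξ) ⟨hx', hsub hx' hξ⟩).trans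
          ((le_max_left _ _).trans (le_max_left _ _)))
        (fun ξ hξ => (hF₁₂ (x, ξ) ⟨hx', hsub hx' hξ⟩).trans
          ((le_max_right _ _).trans (le_max_left _ _)))
        (hwle x hx' t ht)
        (fun ξ hξ => hvle ξ (hsub hx' hξ) t (htime ht hξ))
        (fun ξ hξ => hwle ξ (hsub hx' hξ) t (htime ht hξ)))
    x₀ hx₀ t₀ ht₀
  have hw₀ := transport_abs_le hw (T := T) hμ₂ le_rfl (mul_nonneg hC0 hN0) hκ hbc_w
    (fun x hx t ht => by
      have hx' := Ioo_subset_Icc_self hx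
      rw [hpde_w x hx' t (hKsub (hmemK x hx' t ht)).2]
      exact abs_source_le hx' hN0 hκ.le ((hH₂ x hx').trans (le_max_right _ _))
        (fun ξ hξ => (hF₂₁ (x, ξ) ⟨hx', hsub hx' hξ⟩).trans
          ((le_max_left _ _).trans (le_max_right _ _)))
        (fun ξ hξ => (hF₂₂ (x, ξ) ⟨hx', hsub hx' hξ⟩).trans
          ((le_max_right _ _).trans (le_max_right _ _)))
        (hvle x hx' t ht)
        (fun ξ hξ => hvle ξ (hsub hx' hξ) t (htime ht hξ))
        (fun ξ hξ => hwle ξ (hsub hx' hξ) t (htime ht hξ)))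
    x₀ hx₀ t₀ ht₀
  have hNle : N ≤ 2 * (C * N / (κ * μ₂)) := by
    have h := mul_le_mul_of_nonneg_right (add_le_add hv₀ hw₀)
      (Real.exp_pos (-(κ * (L - x₀)))).le
    rw [← hN, ← two_mul, mul_assoc, mul_assoc, ← Real.exp_add, add_neg_cancel, Real.exp_zero,
      mul_one] at h
    exact h
  have hNz : N = 0 := by
    rw [hκμ, ← mul_div_assoc, le_div_iff₀ (by positivity)] at hNle
    linarith
  have h1 := hvle x₁ hx₁ T ⟨hT, le_rfl⟩
  have h2 := hwle x₁ hx₁ T ⟨hT, le_rfl⟩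
  rw [hNz, zero_mul] at h1 h2
  exact ⟨abs_nonpos_iff.1 h1, abs_nonpos_iff.1 h2⟩


/-- Lemma 3: finite-time convergence of the observer error target system. All
four states vanish for t ≥ t_o, where t_o = L/ε₁ + L/ε₂ + L/μ₂. -/
theorem stmt_16
    (L ε₁ ε₂ μ₁ μ₂ ks kf : ℝ)
    (hL : 0 < L) (hε₁ : 0 < ε₁) (hε : ε₁ ≤ ε₂) (hμ₂ : 0 < μ₂) (hμ : μ₂ ≤ μ₁)
    (a₁ a₂ h₁ h₂ lam g₁₁ g₁₂ g₂₁ g₂₂ : ℝ → ℝ)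
    (d₁₁ d₁₂ d₂₁ d₂₂ f₁₁ f₁₂ f₂₁ f₂₂ : ℝ → ℝ → ℝ)
    (ha₁ : ContinuousOn a₁ (Set.Icc 0 L)) (ha₂ : ContinuousOn a₂ (Set.Icc 0 L))
    (hh₁ : ContinuousOn h₁ (Set.Icc 0 L)) (hh₂ : ContinuousOn h₂ (Set.Icc 0 L))
    (hlam : ContinuousOn lam (Set.Icc 0 L))
    (hg₁₁ : ContinuousOn g₁₁ (Set.Icc 0 L)) (hg₁₂ : ContinuousOn g₁₂ (Set.Icc 0 L))
    (hg₂₁ : ContinuousOn g₂₁ (Set.Icc 0 L)) (hg₂₂ : ContinuousOn g₂₂ (Set.Icc 0 L))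
    (hd₁₁ : ContinuousOn (Function.uncurry d₁₁) (Set.Icc 0 L ×ˢ Set.Icc 0 L))
    (hd₁₂ : ContinuousOn (Function.uncurry d₁₂) (Set.Icc 0 L ×ˢ Set.Icc 0 L))
    (hd₂₁ : ContinuousOn (Function.uncurry d₂₁) (Set.Icc 0 L ×ˢ Set.Icc 0 L))
    (hd₂₂ : ContinuousOn (Function.uncurry d₂₂) (Set.Icc 0 L ×ˢ Set.Icc 0 L))
    (hf₁₁ : ContinuousOn (Function.uncurry f₁₁) (Set.Icc 0 L ×ˢ Set.Icc 0 L))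
    (hf₁₂ : ContinuousOn (Function.uncurry f₁₂) (Set.Icc 0 L ×ˢ Set.Icc 0 L))
    (hf₂₁ : ContinuousOn (Function.uncurry f₂₁) (Set.Icc 0 L ×ˢ Set.Icc 0 L))
    (hf₂₂ : ContinuousOn (Function.uncurry f₂₂) (Set.Icc 0 L ×ˢ Set.Icc 0 L))
    (αs αf βs βf : ℝ → ℝ → ℝ)
    (hαs : ContDiffOn ℝ 1 (Function.uncurry αs) (Set.Icc 0 L ×ˢ Set.Ici 0))
    (hαf : ContDiffOn ℝ 1 (Function.uncurry αf) (Set.Icc 0 L ×ˢ Set.Ici 0))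
    (hβs : ContDiffOn ℝ 1 (Function.uncurry βs) (Set.Icc 0 L ×ˢ Set.Ici 0))
    (hβf : ContDiffOn ℝ 1 (Function.uncurry βf) (Set.Icc 0 L ×ˢ Set.Ici 0))
    (hpde_αs : ∀ x ∈ Set.Icc (0:ℝ) L, ∀ t ∈ Set.Ici (0:ℝ),
      deriv (fun s => αs x s) t + ε₁ * deriv (fun y => αs y t) x
        = a₁ x * αs x t + g₁₁ x * βs x t + g₁₂ x * βf x t
          + ∫ ξ in x..L, (d₁₁ x ξ * βs ξ t + d₁₂ x ξ * βf ξ t))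
    (hpde_αf : ∀ x ∈ Set.Icc (0:ℝ) L, ∀ t ∈ Set.Ici (0:ℝ),
      deriv (fun s => αf x s) t + ε₂ * deriv (fun y => αf y t) x
        = a₂ x * αf x t + g₂₁ x * βs x t + g₂₂ x * βf x t
          + ∫ ξ in x..L, (d₂₁ x ξ * βs ξ t + d₂₂ x ξ * βf ξ t))
    (hpde_βs : ∀ x ∈ Set.Icc (0:ℝ) L, ∀ t ∈ Set.Ici (0:ℝ),
      deriv (fun s => βs x s) t - μ₁ * deriv (fun y => βs y t) x
        = h₁ x * βf x t
          + ∫ ξ in x..L, (f₁₁ x ξ * βs ξ t + f₁₂ x ξ * βf ξ t))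
    (hpde_βf : ∀ x ∈ Set.Icc (0:ℝ) L, ∀ t ∈ Set.Ici (0:ℝ),
      deriv (fun s => βf x s) t - μ₂ * deriv (fun y => βf y t) x
        = h₂ x * βs x t
          + ∫ ξ in x..L, (f₂₁ x ξ * βs ξ t + f₂₂ x ξ * βf ξ t))
    (hbc_αs : ∀ t ∈ Set.Ici (0:ℝ), αs 0 t = ks * βs 0 t)
    (hbc_αf : ∀ t ∈ Set.Ici (0:ℝ),
      αf 0 t = kf * βf 0 t - ∫ x in (0:ℝ)..L, lam x * αs x t)
    (hbc_βs : ∀ t ∈ Set.Ici (0:ℝ), βs L t = 0)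
    (hbc_βf : ∀ t ∈ Set.Ici (0:ℝ), βf L t = 0) :
    ∀ x ∈ Set.Icc (0:ℝ) L, ∀ t : ℝ, L / ε₁ + L / ε₂ + L / μ₂ ≤ t →
      αs x t = 0 ∧ αf x t = 0 ∧ βs x t = 0 ∧ βf x t = 0 := by
  have hβ := left_going_system_eq_zero hL hμ₂ hμ hh₁ hh₂ hf₁₁ hf₁₂ hf₂₁ hf₂₂ hβs hβf
    hpde_βs hpde_βf hbc_βs hbc_βf
  have hε₂ : 0 < ε₂ := hε₁.trans_le hε
  have hτ : 0 ≤ L / μ₂ := by positivity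
  have hτ₁ : 0 ≤ L / ε₁ := by positivity
  have hβ0 : ∀ x ∈ Icc 0 L, ∀ t, L / μ₂ ≤ t → βs x t = 0 ∧ βf x t = 0 := fun x hx t ht =>
    hβ x hx t (le_trans (by have := hx.1; gcongr; linarith) ht)
  have hint (k₁ k₂ : ℝ → ℝ) {x t : ℝ} (hx : x ∈ Icc 0 L) (ht : L / μ₂ ≤ t) :
      ∫ ξ in x..L, (k₁ ξ * βs ξ t + k₂ ξ * βf ξ t) = 0 := by
    refine intervalIntegral.integral_zero_ae (.of_forall fun ξ hξ => ?_)
    rw [uIoc_of_le hx.2] at hξ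
    obtain ⟨h1, h2⟩ := hβ0 ξ ⟨hx.1.trans hξ.1.le, hξ.2⟩ t ht
    simp [h1, h2]
  have h0 : (0:ℝ) ∈ Icc 0 L := ⟨le_rfl, hL.le⟩
  have hαs0 := transport_eq_zero hαs hε₁ hτ ha₁
    (fun x hx t ht => by
      have hx' := Ioo_subset_Icc_self hx
      rw [hpde_αs x hx' t (hτ.trans ht), hint _ _ hx' ht, (hβ0 x hx' t ht).1,
        (hβ0 x hx' t ht).2]
      ring)
    (fun t ht => by rw [hbc_αs t (hτ.trans ht), (hβ0 0 h0 t ht).1, mul_zero])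
  have hαf0 := transport_eq_zero hαf hε₂ (τ := L / μ₂ + L / ε₁) (by positivity) ha₂
    (fun x hx t ht => by
      have hx' := Ioo_subset_Icc_self hx
      have ht' : L / μ₂ ≤ t := by linarith
      rw [hpde_αf x hx' t (hτ.trans ht'), hint _ _ hx' ht', (hβ0 x hx' t ht').1,
        (hβ0 x hx' t ht').2]
      ring)
    (fun t ht => by
      have ht' : L / μ₂ ≤ t := by linarith
      have hz : ∫ x in (0:ℝ)..L, lam x * αs x t = 0 := by
        refine intervalIntegral.integral_zero_ae (.of_forall fun x hx => ?_)
        rw [uIoc_of_le hL.le] at hx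
        rw [hαs0 x (Ioc_subset_Icc_self hx) t (le_trans (by have := hx.2; gcongr) ht), mul_zero]
      rw [hbc_αf t (hτ.trans ht'), (hβ0 0 h0 t ht').2, hz, mul_zero, sub_zero])
  intro x hx t ht
  have hx₁ : x / ε₁ ≤ L / ε₁ := by have := hx.2; gcongr
  have hx₂ : x / ε₂ ≤ L / ε₂ := by have := hx.2; gcongr
  have hL₂ : 0 ≤ L / ε₂ := by positivity
  exact ⟨hαs0 x hx t (by linarith), hαf0 x hx t (by linarith),
    hβ0 x hx t (by linarith)⟩
end
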